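/- arXiv:nlin/0511062 — 8 statements merged into one kernel-verified Lean document; each statement's English description precedes it below -/
import Mathlib

section
/- Let U ⊆ ℝ^n be open and let g_1,…,g_n, v_1,…,v_n, V, W : U → ℝ be smooth functions satisfying, at every point of U and for all i,k ∈ {1,…,n}: (A1) ∂v_i/∂λ_i = 0; (A2) g_k·(∂v_k/∂λ_i) = (∂g_k/∂λ_i)·(v_k − v_i); (A3) ∂W/∂λ_i = v_i·(∂V/∂λ_i). Define L(λ,p) = (1/2)·Σ_{i=1}^n g_i(λ)p_i² − V(λ) and L_r(λ,p) = (1/2)·Σ_{i=1}^n g_i(λ)v_i(λ)p_i² − W(λ). Then for every smooth curve λ : ℝ → U and every x ∈ ℝ: Σ_{i=1}^n E_i(L)[λ](x)·v_i(λ(x))·λ_i'(x) = Σ_{i=1}^n E_i(L_r)[λ](x)·λ_i'(x). -/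
open scoped BigOperators

/-- Partial derivative of `f` with respect to the `i`-th coordinate at `q`. -/
noncomputable def pd {n : ℕ} (f : (Fin n → ℝ) → ℝ) (i : Fin n) (q : Fin n → ℝ) : ℝ :=
  deriv (fun t => f (Function.update q i t)) (q i)

/-- Euler–Lagrange expression `E_l(L)[c](x)` of a Lagrangian density `L(q,p)`
along a curve `c`. -/
noncomputable def elExpr {n : ℕ} (L : (Fin n → ℝ) → (Fin n → ℝ) → ℝ) (l : Fin n)
    (c : ℝ → Fin n → ℝ) (x : ℝ) : ℝ :=
  pd (fun vq => L vq (deriv c x)) l (c x)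
    - deriv (fun y => pd (fun vp => L (c y) vp) l (deriv c y)) x

theorem hasPd {n : ℕ} {f : (Fin n → ℝ) → ℝ} {q : Fin n → ℝ} (hf : DifferentiableAt ℝ f q)
    (i : Fin n) :
    HasDerivAt (fun t => f (Function.update q i t)) (pd f i q) (q i) := by
  have h1 : HasDerivAt (fun t => Function.update q i t) (Pi.single i (1:ℝ)) (q i) :=
    hasDerivAt_update q i (q i)
  have h2 : DifferentiableAt ℝ f (Function.update q i (q i)) := by simpa using hf
  have h3 := h2.hasFDerivAt.comp_hasDerivAt (q i) h1
  exact h3.differentiableAt.hasDerivAt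

theorem pd_eq {n : ℕ} {f : (Fin n → ℝ) → ℝ} {q : Fin n → ℝ} (hf : DifferentiableAt ℝ f q)
    (i : Fin n) : pd f i q = fderiv ℝ f q (Pi.single i 1) := by
  have h1 : HasDerivAt (fun t => Function.update q i t) (Pi.single i (1:ℝ)) (q i) :=
    hasDerivAt_update q i (q i)
  have h2 : DifferentiableAt ℝ f (Function.update q i (q i)) := by simpa using hf
  have h3 := h2.hasFDerivAt.comp_hasDerivAt (q i) h1
  rw [Function.update_eq_self] at h3
  exact h3.deriv

theorem fderiv_sum_pd {n : ℕ} {f : (Fin n → ℝ) → ℝ} {q : Fin n → ℝ}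
    (hf : DifferentiableAt ℝ f q) (p : Fin n → ℝ) :
    fderiv ℝ f q p = ∑ k, pd f k q * p k := by
  conv_lhs => rw [pi_eq_sum_univ' p]
  rw [map_sum]
  refine Finset.sum_congr rfl fun k _ => ?_
  rw [pd_eq hf, map_smul, smul_eq_mul, mul_comm]

theorem pd_mul {n : ℕ} {f h : (Fin n → ℝ) → ℝ} {q : Fin n → ℝ} (hf : DifferentiableAt ℝ f q)
    (hh : DifferentiableAt ℝ h q) (i : Fin n) :
    pd (fun y => f y * h y) i q = pd f i q * h q + f q * pd h i q := by
  have := ((hasPd hf i).mul (hasPd hh i)).deriv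
  simp only [Function.update_eq_self] at this
  exact this

theorem elExpr_formula {n : ℕ} (h : Fin n → (Fin n → ℝ) → ℝ) (Z : (Fin n → ℝ) → ℝ)
    (c : ℝ → Fin n → ℝ) (hc : ContDiff ℝ (⊤ : ℕ∞) c) (x : ℝ)
    (hh : ∀ i, DifferentiableAt ℝ (h i) (c x)) (hZ : DifferentiableAt ℝ Z (c x)) (i : Fin n) :
    elExpr (fun lam p => (1 / 2) * ∑ j : Fin n, h j lam * p j ^ 2 - Z lam) i c x
      = (1 / 2) * ∑ j, pd (h j) i (c x) * deriv c x j ^ 2 - pd Z i (c x)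
        - ((∑ k, pd (h i) k (c x) * deriv c x k) * deriv c x i
          + h i (c x) * deriv (deriv c) x i) := by
  unfold elExpr
  congr 1
  · have h1 := HasDerivAt.fun_sum (u := Finset.univ)
      (fun j (_ : j ∈ Finset.univ) => (hasPd (hh j) i).mul_const (deriv c x j ^ 2))
    exact ((h1.const_mul (1/2 : ℝ)).sub (hasPd hZ i)).deriv
  · have key : ∀ y, pd (fun vp => (1 / 2) * ∑ j : Fin n, h j (c y) * vp j ^ 2 - Z (c y)) i
        (deriv c y) = h i (c y) * deriv c y i := by
      intro y
      have h0 : ∀ j : Fin n, HasDerivAt (fun t => Function.update (deriv c y) i t j)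
          ((Pi.single i (1:ℝ) : Fin n → ℝ) j) (deriv c y i) :=
        fun j => hasDerivAt_pi.1 (hasDerivAt_update (deriv c y) i (deriv c y i)) j
      have h1 := HasDerivAt.fun_sum (u := Finset.univ)
        (fun j (_ : j ∈ Finset.univ) => ((h0 j).pow 2).const_mul (h j (c y)))
      have h2 := ((h1.const_mul (1/2 : ℝ)).sub_const (Z (c y))).deriv
      refine h2.trans ?_
      rw [Finset.sum_eq_single i]
      · simp
        ring
      · intro j _ hj
        simp [Pi.single_apply, hj]
      · simp
    simp only [key]
    have hc1 : HasDerivAt c (deriv c x) x :=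
      (hc.differentiable (by simp) x).hasDerivAt
    have hc2 : HasDerivAt (deriv c) (deriv (deriv c) x) x := by
      have := (contDiff_infty_iff_deriv.1 hc).2
      exact (this.differentiable (by simp) x).hasDerivAt
    have h3 := ((hh i).hasFDerivAt.comp_hasDerivAt x hc1).mul (hasDerivAt_pi.1 hc2 i)
    rw [fderiv_sum_pd (hh i)] at h3
    exact h3.deriv

/-- under the Stäckel compatibility conditions (A1)–(A3) on an open set `U`,
for `L(λ,p) = ½·Σ g_i(λ)p_i² − V(λ)` and `L_r(λ,p) = ½·Σ g_i(λ)v_i(λ)p_i² − W(λ)` and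
every smooth curve `λ : ℝ → U`:
`Σ_i E_i(L)[λ](x)·v_i(λ(x))·λ_i'(x) = Σ_i E_i(L_r)[λ](x)·λ_i'(x)`. -/
theorem stackel_el_identity
    (n : ℕ) (hn : 1 ≤ n) (U : Set (Fin n → ℝ)) (hU : IsOpen U)
    (g v : Fin n → (Fin n → ℝ) → ℝ) (V W : (Fin n → ℝ) → ℝ)
    (hg : ∀ i, ContDiffOn ℝ (⊤ : ℕ∞) (g i) U)
    (hv : ∀ i, ContDiffOn ℝ (⊤ : ℕ∞) (v i) U)
    (hV : ContDiffOn ℝ (⊤ : ℕ∞) V U)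
    (hW : ContDiffOn ℝ (⊤ : ℕ∞) W U)
    (hA1 : ∀ i : Fin n, ∀ q ∈ U, pd (v i) i q = 0)
    (hA2 : ∀ i k : Fin n, ∀ q ∈ U,
      g k q * pd (v k) i q = pd (g k) i q * (v k q - v i q))
    (hA3 : ∀ i : Fin n, ∀ q ∈ U, pd W i q = v i q * pd V i q)
    (c : ℝ → Fin n → ℝ) (hc : ContDiff ℝ (⊤ : ℕ∞) c) (hcU : ∀ x : ℝ, c x ∈ U)
    (x : ℝ) :
    ∑ i : Fin n,
        elExpr (fun lam p => (1 / 2) * ∑ j : Fin n, g j lam * p j ^ 2 - V lam) i c x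
          * v i (c x) * deriv c x i
      = ∑ i : Fin n,
          elExpr (fun lam p => (1 / 2) * ∑ j : Fin n, g j lam * v j lam * p j ^ 2 - W lam)
            i c x * deriv c x i := by
  have hd : ∀ f : (Fin n → ℝ) → ℝ, ContDiffOn ℝ (⊤ : ℕ∞) f U → DifferentiableAt ℝ f (c x) :=
    fun f hf => (hf.contDiffAt (hU.mem_nhds (hcU x))).differentiableAt (by simp)
  have dg := fun i => hd _ (hg i)
  have dv := fun i => hd _ (hv i)
  have e2 := fun i => elExpr_formula (fun j q => g j q * v j q) W c hc x
    (fun j => (dg j).mul (dv j)) (hd _ hW) i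
  have e1 := fun i => elExpr_formula g V c hc x dg (hd _ hV) i
  simp only [e1, e2, pd_mul (dg _) (dv _), hA3 _ _ (hcU x)]
  generalize deriv (deriv c) x = a
  generalize deriv c x = p
  have A2 := fun i k => hA2 i k _ (hcU x)
  generalize c x = q at *
  have hs : ∑ i, (∑ j, g j q * pd (v j) i q * p j ^ 2) * p i
      = ∑ i, (∑ k, g i q * pd (v i) k q * p k) * p i * p i := by
    simp only [Finset.sum_mul]
    rw [Finset.sum_comm]
    refine Finset.sum_congr rfl fun i _ => Finset.sum_congr rfl fun k _ => by ring
  have hi : ∀ i, ∑ j, (pd (g j) i q * v j q + g j q * pd (v j) i q) * p j ^ 2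
      = (∑ j, pd (g j) i q * p j ^ 2) * v i q + 2 * ∑ j, g j q * pd (v j) i q * p j ^ 2 := by
    intro i
    rw [Finset.sum_mul, Finset.mul_sum, ← Finset.sum_add_distrib]
    refine Finset.sum_congr rfl fun j _ => ?_
    linear_combination (-p j ^ 2) * A2 i j
  have hk : ∀ i, ∑ k, (pd (g i) k q * v i q + g i q * pd (v i) k q) * p k
      = (∑ k, pd (g i) k q * p k) * v i q + ∑ k, g i q * pd (v i) k q * p k := by
    intro i
    rw [Finset.sum_mul, ← Finset.sum_add_distrib]
    exact Finset.sum_congr rfl fun j _ => by ring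
  simp only [hi, hk]
  rw [← sub_eq_zero, ← Finset.sum_sub_distrib]
  rw [← sub_eq_zero, ← Finset.sum_sub_distrib] at hs
  rw [← neg_eq_zero, ← hs, ← Finset.sum_neg_distrib]
  exact Finset.sum_congr rfl fun i _ => by ring
end

section
/- Let U ⊆ ℝ^n be open and let g_1,…,g_n, v_1,…,v_n, V, W : U → ℝ be smooth functions satisfying, at every point of U and for all i,k ∈ {1,…,n}: (A1) ∂v_i/∂λ_i = 0; (A2) g_k·(∂v_k/∂λ_i) = (∂g_k/∂λ_i)·(v_k − v_i); (A3) ∂W/∂λ_i = v_i·(∂V/∂λ_i). Let P > 0 and let λ : ℝ × ℝ → U, (x,t) ↦ λ(x,t), be smooth, P-periodic in x, and satisfy ∂λ_i/∂t = v_i(λ)·∂λ_i/∂x for all i = 1,…,n. Then the functional I(t) = ∫_0^P [ (1/2)·Σ_{i=1}^n g_i(λ(x,t))·(∂λ_i/∂x)² − V(λ(x,t)) ] dx is constant in t. -/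
open scoped BigOperators

theorem kf_pd {n : ℕ} (f : (Fin n → ℝ) → ℝ) (q : Fin n → ℝ) (hf : DifferentiableAt ℝ f q)
    (i : Fin n) : pd f i q = fderiv ℝ f q (Pi.single i 1) := by
  unfold pd
  have h1 : HasDerivAt (Function.update q i) (Pi.single i (1:ℝ)) (q i) := hasDerivAt_update q i (q i)
  have h2 : HasFDerivAt f (fderiv ℝ f q) (Function.update q i (q i)) := by
    rw [Function.update_eq_self]; exact hf.hasFDerivAt
  exact (h2.comp_hasDerivAt _ h1).deriv

theorem kf_lin {n : ℕ} (f : (Fin n → ℝ) → ℝ) (q : Fin n → ℝ) (hf : DifferentiableAt ℝ f q)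
    (w : Fin n → ℝ) : fderiv ℝ f q w = ∑ k, pd f k q * w k := by
  conv_lhs => rw [← Finset.univ_sum_single w]
  rw [map_sum]
  refine Finset.sum_congr rfl fun k _ => ?_
  rw [kf_pd f q hf k]
  have : (Pi.single k (w k) : Fin n → ℝ) = w k • Pi.single k (1:ℝ) := by
    rw [← Pi.single_smul]; simp
  rw [this, map_smul, smul_eq_mul, mul_comm]

theorem kf_chain {n : ℕ} (f : (Fin n → ℝ) → ℝ) (l : ℝ × ℝ → Fin n → ℝ) (p w : ℝ × ℝ)
    (hf : DifferentiableAt ℝ f (l p)) (hl : DifferentiableAt ℝ l p) :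
    fderiv ℝ (fun z => f (l z)) p w = ∑ k, pd f k (l p) * fderiv ℝ (fun z => l z k) p w := by
  have h := (hf.hasFDerivAt.comp p hl.hasFDerivAt).fderiv
  have h' : fderiv ℝ (fun z => f (l z)) p w = fderiv ℝ f (l p) (fderiv ℝ l p w) := by
    change fderiv ℝ (f ∘ l) p w = _
    rw [h]; rfl
  rw [h', kf_lin f _ hf]
  refine Finset.sum_congr rfl fun k _ => ?_
  have := (hasFDerivAt_pi'.1 hl.hasFDerivAt k).fderiv
  rw [this]; rfl

theorem kf_symm (f : ℝ × ℝ → ℝ) (hf : ContDiff ℝ (⊤ : ℕ∞) f) (p u w : ℝ × ℝ) :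
    fderiv ℝ (fun z => fderiv ℝ f z u) p w = fderiv ℝ (fun z => fderiv ℝ f z w) p u := by
  have hd : DifferentiableAt ℝ (fderiv ℝ f) p :=
    ((hf.fderiv_right (m := 1) (by norm_cast)).differentiable (by norm_num)) p
  have hs : IsSymmSndFDerivAt ℝ f p := hf.contDiffAt.isSymmSndFDerivAt (by simp; norm_cast)
  rw [fderiv_clm_apply hd (differentiableAt_const _), fderiv_clm_apply hd (differentiableAt_const _)]
  simpa using hs w u

/-- under the Stäckel compatibility conditions (A1)–(A3) on an open set `U`,
if `λ(x,t) ∈ U` is smooth, `P`-periodic in `x` and satisfies the Killing dispersionless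
system `∂λ_i/∂t = v_i(λ)·∂λ_i/∂x`, then
`I(t) = ∫₀ᴾ [½·Σ g_i(λ)·(∂λ_i/∂x)² − V(λ)] dx` is constant in `t`. -/
theorem killing_flow_invariant_functional
    (n : ℕ) (hn : 1 ≤ n) (U : Set (Fin n → ℝ)) (hU : IsOpen U)
    (g v : Fin n → (Fin n → ℝ) → ℝ) (V W : (Fin n → ℝ) → ℝ)
    (hg : ∀ i, ContDiffOn ℝ (⊤ : ℕ∞) (g i) U)
    (hv : ∀ i, ContDiffOn ℝ (⊤ : ℕ∞) (v i) U)
    (hV : ContDiffOn ℝ (⊤ : ℕ∞) V U)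
    (hW : ContDiffOn ℝ (⊤ : ℕ∞) W U)
    (hA1 : ∀ i : Fin n, ∀ q ∈ U, pd (v i) i q = 0)
    (hA2 : ∀ i k : Fin n, ∀ q ∈ U,
      g k q * pd (v k) i q = pd (g k) i q * (v k q - v i q))
    (hA3 : ∀ i : Fin n, ∀ q ∈ U, pd W i q = v i q * pd V i q)
    (P : ℝ) (hP : 0 < P)
    (lam : ℝ → ℝ → Fin n → ℝ)
    (hsm : ContDiff ℝ (⊤ : ℕ∞) (fun p : ℝ × ℝ => lam p.1 p.2))
    (hmem : ∀ x t : ℝ, lam x t ∈ U)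
    (hper : ∀ x t : ℝ, lam (x + P) t = lam x t)
    (hevol : ∀ (x t : ℝ) (i : Fin n),
      deriv (fun s => lam x s i) t = v i (lam x t) * deriv (fun y => lam y t i) x) :
    ∀ t₁ t₂ : ℝ,
      (∫ x in (0:ℝ)..P,
          ((1 / 2) * ∑ i : Fin n, g i (lam x t₁) * (deriv (fun y => lam y t₁ i) x) ^ 2
            - V (lam x t₁)))
        = ∫ x in (0:ℝ)..P,
            ((1 / 2) * ∑ i : Fin n, g i (lam x t₂) * (deriv (fun y => lam y t₂ i) x) ^ 2
              - V (lam x t₂)) := by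
  intro t₁ t₂
  set l : ℝ × ℝ → Fin n → ℝ := fun p => lam p.1 p.2 with hl
  have hlm : ∀ p, l p ∈ U := fun p => hmem _ _
  have hld : ∀ p, DifferentiableAt ℝ l p := fun p => hsm.differentiable (by simp) p
  have hlc : ∀ i, ContDiff ℝ (⊤ : ℕ∞) (fun p => l p i) := fun i => contDiff_pi.1 hsm i
  have hlcd : ∀ i p, DifferentiableAt ℝ (fun p => l p i) p :=
    fun i p => (hlc i).differentiable (by simp) p
  set A : Fin n → ℝ × ℝ → ℝ := fun i p => fderiv ℝ (fun z => l z i) p (1, 0) with hA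
  have hAx : ∀ i x t, deriv (fun y => lam y t i) x = A i (x, t) := by
    intro i x t
    have h1 : HasDerivAt (fun y : ℝ => (y, t)) ((1:ℝ), (0:ℝ)) x :=
      (hasDerivAt_id x).prodMk (hasDerivAt_const x t)
    exact ((hlcd i (x, t)).hasFDerivAt.comp_hasDerivAt x h1).deriv
  have hAt : ∀ i p, fderiv ℝ (fun z => l z i) p (0, 1) = v i (l p) * A i p := by
    rintro i ⟨x, t⟩
    have h1 : HasDerivAt (fun y : ℝ => (x, y)) ((0:ℝ), (1:ℝ)) t :=
      (hasDerivAt_const t x).prodMk (hasDerivAt_id t)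
    rw [← hAx, ← hevol x t i]
    exact ((hlcd i (x, t)).hasFDerivAt.comp_hasDerivAt t h1).deriv.symm
  have hAc : ∀ i, ContDiff ℝ (⊤ : ℕ∞) (A i) := fun i =>
    ((hlc i).fderiv_right (m := (⊤ : ℕ∞)) (by norm_cast)).clm_apply contDiff_const
  have hAd : ∀ i p, DifferentiableAt ℝ (A i) p :=
    fun i p => (hAc i).differentiable (by simp) p
  have hcomp : ∀ f : (Fin n → ℝ) → ℝ, ContDiffOn ℝ (⊤ : ℕ∞) f U →
      ContDiff ℝ (⊤ : ℕ∞) (fun p => f (l p)) := by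
    intro f hf
    exact hf.comp_contDiff hsm hlm
  have hdif : ∀ f : (Fin n → ℝ) → ℝ, ContDiffOn ℝ (⊤ : ℕ∞) f U → ∀ p, DifferentiableAt ℝ f (l p) :=
    fun f hf p => (hf.contDiffAt (hU.mem_nhds (hlm p))).differentiableAt (by simp)
  have hcd : ∀ f : (Fin n → ℝ) → ℝ, ContDiffOn ℝ (⊤ : ℕ∞) f U →
      ∀ p, DifferentiableAt ℝ (fun p => f (l p)) p :=
    fun f hf p => (hcomp f hf).differentiable (by simp) p
  have hX : ∀ f : (Fin n → ℝ) → ℝ, ContDiffOn ℝ (⊤ : ℕ∞) f U → ∀ p,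
      fderiv ℝ (fun z => f (l z)) p (1, 0) = ∑ k, pd f k (l p) * A k p :=
    fun f hf p => kf_chain f l p _ (hdif f hf p) (hld p)
  have hT : ∀ f : (Fin n → ℝ) → ℝ, ContDiffOn ℝ (⊤ : ℕ∞) f U → ∀ p,
      fderiv ℝ (fun z => f (l z)) p (0, 1) = ∑ k, pd f k (l p) * (v k (l p) * A k p) := by
    intro f hf p
    rw [kf_chain f l p _ (hdif f hf p) (hld p)]
    simp only [hAt]
  have hAA : ∀ i p, fderiv ℝ (A i) p (0, 1) =
      v i (l p) * fderiv ℝ (A i) p (1, 0) + A i p * ∑ k, pd (v i) k (l p) * A k p := by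
    intro i p
    have h := kf_symm _ (hlc i) p (1, 0) (0, 1)
    simp only [hAt] at h
    rw [← hX (v i) (hv i) p]
    refine h.trans ?_
    rw [((hcd (v i) (hv i) p).hasFDerivAt.fun_mul (hAd i p).hasFDerivAt).fderiv]
    simp
  -- densities
  set F : ℝ × ℝ → ℝ := fun p => (1 / 2) * ∑ i : Fin n, g i (l p) * (A i p) ^ 2 - V (l p) with hF
  set M : ℝ × ℝ → ℝ :=
    fun p => (1 / 2) * ∑ i : Fin n, g i (l p) * v i (l p) * (A i p) ^ 2 - W (l p) with hM
  have hFc : ContDiff ℝ (⊤ : ℕ∞) F :=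
    (contDiff_const.mul (ContDiff.sum fun i _ => (hcomp _ (hg i)).mul ((hAc i).pow 2))).sub (hcomp _ hV)
  have hMc : ContDiff ℝ (⊤ : ℕ∞) M :=
    (contDiff_const.mul (ContDiff.sum fun i _ =>
      ((hcomp _ (hg i)).mul (hcomp _ (hv i))).mul ((hAc i).pow 2))).sub (hcomp _ hW)
  have hFd : ∀ p, HasFDerivAt F (fderiv ℝ F p) p :=
    fun p => (hFc.differentiable (by simp) p).hasFDerivAt
  have hMd : ∀ p, HasFDerivAt M (fderiv ℝ M p) p :=
    fun p => (hMc.differentiable (by simp) p).hasFDerivAt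
  have key : ∀ p, fderiv ℝ M p (1, 0) = fderiv ℝ F p (0, 1) := by
    intro p
    have e1 := (((HasFDerivAt.fun_sum (u := Finset.univ) fun i _ =>
      ((hcd (g i) (hg i) p).hasFDerivAt.mul
      ((hAd i p).hasFDerivAt.pow 2))).const_mul (1/2 : ℝ)).sub (hcd V hV p).hasFDerivAt).fderiv
    have e2 := (((HasFDerivAt.fun_sum (u := Finset.univ) fun i _ =>
      (((hcd (g i) (hg i) p).hasFDerivAt.mul (hcd (v i) (hv i) p).hasFDerivAt).mul
      ((hAd i p).hasFDerivAt.pow 2))).const_mul (1/2 : ℝ)).sub (hcd W hW p).hasFDerivAt).fderiv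
    have e1' := congrArg (fun L => L ((0:ℝ), (1:ℝ))) e1
    have e2' := congrArg (fun L => L ((1:ℝ), (0:ℝ))) e2
    refine (e2'.trans ?_).trans e1'.symm
    simp only [ContinuousLinearMap.sub_apply, ContinuousLinearMap.smul_apply,
      ContinuousLinearMap.sum_apply, ContinuousLinearMap.add_apply, smul_eq_mul]
    simp only [hX _ (hg _), hX _ (hv _), hX _ hW, hT _ (hg _), hT _ hV, hAA, Pi.mul_apply]
    congr 1
    · congr 1
      refine Finset.sum_congr rfl fun i _ => ?_
      have hs : g i (l p) * ∑ k, pd (v i) k (l p) * A k p =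
          v i (l p) * (∑ k, pd (g i) k (l p) * A k p) -
            ∑ k, pd (g i) k (l p) * (v k (l p) * A k p) := by
        rw [Finset.mul_sum, Finset.mul_sum, ← Finset.sum_sub_distrib]
        refine Finset.sum_congr rfl fun k _ => ?_
        linear_combination A k p * hA2 k i (l p) (hlm p)
      simp
      linear_combination (-(A i p)^2) * hs
    · refine Finset.sum_congr rfl fun k _ => ?_
      rw [hA3 k (l p) (hlm p)]; ring
  have hMper : ∀ t, M (P, t) = M (0, t) := by
    intro t
    have h0 : l (P, t) = l (0, t) := by
      have := hper 0 t
      rw [zero_add] at this; exact this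
    have h1 : ∀ i, A i (P, t) = A i (0, t) := by
      intro i
      rw [← hAx, ← hAx]
      have h2 : (fun y => lam y t i) = fun y => lam (y + P) t i := by
        funext y; rw [hper]
      conv_rhs => rw [h2, deriv_comp_add_const (fun y => lam y t i) P 0, zero_add]
    simp only [hM, h0, h1]
  have hdiv := MeasureTheory.integral2_divergence_prod_of_hasFDerivAt M (fun p => - F p)
    (fun p => fderiv ℝ M p) (fun p => - fderiv ℝ F p) 0 t₁ P t₂
    hMc.continuous.continuousOn hFc.continuous.neg.continuousOn
    (fun p _ => hMd p) (fun p _ => (hFd p).neg) ?_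
  · simp only [ContinuousLinearMap.neg_apply, key, hMper] at hdiv
    simp at hdiv
    simp only [hAx]
    change (∫ x in (0:ℝ)..P, F (x, t₁)) = ∫ x in (0:ℝ)..P, F (x, t₂)
    linarith
  · simp [key]
end

section
/- For every α ∈ {1,…,n−1}, every i ∈ {1,…,n−α} and every k ∈ ℤ, the Benenti potentials satisfy ∂V_1^{(k)}/∂q_i = ∂V_1^{(k+α)}/∂q_{i+α} at every point of U_n. -/
open scoped BigOperators

/-- Coordinate of `q` with the conventions `q₀ = 1` and `q_α = 0` for `α < 0` or `α > n`
(1-based indexing by an integer). -/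
def qc (n : ℕ) (q : Fin n → ℝ) (r : ℤ) : ℝ :=
  if r = 0 then 1
  else if h : 1 ≤ r ∧ r ≤ (n : ℤ) then q ⟨(r - 1).toNat, by omega⟩ else 0

/-- The Benenti potentials `V_r^{(k)}` in `n` variables. -/
noncomputable def benenti (n : ℕ) (r k : ℤ) (q : Fin n → ℝ) : ℝ :=
  if r < 1 ∨ (n : ℤ) < r then 0
  else if k = 0 then (if r = (n : ℤ) then 1 else 0)
  else if 0 < k then
    benenti n (r + 1) (k - 1) q - qc n q r * benenti n 1 (k - 1) q
  else
    benenti n (r - 1) (k + 1) q - (qc n q (r - 1) / qc n q n) * benenti n n (k + 1) q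
termination_by k.natAbs
decreasing_by all_goals omega

/-- The Lagrangian density `L^{n,m,k}`. -/
noncomputable def lag (n : ℕ) (m k : ℤ) (q p : Fin n → ℝ) : ℝ :=
  (1 / 2) * ∑ i : Fin n, ∑ j : Fin n,
      benenti n 1 (2 * (n : ℤ) - m - ((i : ℕ) + 1) - ((j : ℕ) + 1)) q * p i * p j
    - benenti n 1 k q

/-- The matrix `L` of the Benenti class in Viète coordinates. -/
def Lmat (n : ℕ) (q : Fin n → ℝ) : Matrix (Fin n) (Fin n) ℝ :=
  Matrix.of fun i j => if (j : ℕ) = 0 then -q i else if (j : ℕ) = (i : ℕ) + 1 then 1 else 0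

theorem hom_zero (n : ℕ) (hn : 1 ≤ n) (c : ℕ → ℝ) (F : ℤ → ℝ) (c0 : c 0 = 1) (cn : c n ≠ 0)
    (hF : ∀ k : ℤ, ∑ j ∈ Finset.range (n+1), c j * F (k - j) = 0) (s0 : ℤ)
    (h0 : ∀ j : ℤ, 0 ≤ j → j < n → F (s0 + j) = 0) (k : ℤ) : F k = 0 := by
  have W : ∀ s : ℤ, ∀ j : ℤ, 0 ≤ j → j < n → F (s0 + s + j) = 0 := by
    intro s
    induction s using Int.induction_on with
    | zero => simpa using h0
    | succ s ih =>
      intro j hj0 hj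
      by_cases hjn : j + 1 < n
      · have := ih (j+1) (by omega) hjn
        rw [← this]; congr 1; ring
      · have h := hF (s0 + s + n)
        rw [Finset.sum_range_succ', Finset.sum_eq_zero] at h
        · simp only [c0] at h
          have e : s0 + (s + 1) + j = s0 + s + n - ((0:ℕ):ℤ) := by push_cast; omega
          rw [e]; linarith
        · intro x hx
          rw [Finset.mem_range] at hx
          have := ih (n - (x+1)) (by omega) (by omega)
          have e : s0 + (s:ℤ) + n - ((x+1 : ℕ):ℤ) = s0 + s + (n - (x+1)) := by push_cast; ring
          rw [e, this, mul_zero]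
    | pred s ih =>
      intro j hj0 hj
      by_cases hjn : 1 ≤ j
      · have := ih (j-1) (by omega) (by omega)
        rw [← this]; congr 1; ring
      · have h := hF (s0 + (-(s:ℤ)) + n - 1)
        rw [Finset.sum_range_succ, Finset.sum_eq_zero] at h
        · have e : s0 + (-(s:ℤ) - 1) + j = s0 + (-(s:ℤ)) + n - 1 - (n:ℤ) := by omega
          rw [e]
          simpa [cn] using h
        · intro x hx
          rw [Finset.mem_range] at hx
          have := ih (n - 1 - x) (by omega) (by omega)
          have e : s0 + -(s:ℤ) + n - 1 - (x:ℤ) = s0 + -(s:ℤ) + (n - 1 - x) := by ring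
          rw [e, this, mul_zero]
  have := W (k - s0) 0 le_rfl (by omega)
  rw [← this]; congr 1; ring

theorem ben_out (n : ℕ) (r k : ℤ) (q : Fin n → ℝ) (h : r < 1 ∨ (n : ℤ) < r) :
    benenti n r k q = 0 := by
  rw [benenti, if_pos h]

theorem ben_step (n : ℕ) (r k : ℤ) (q : Fin n → ℝ) (hq : qc n q n ≠ 0)
    (h1 : 1 ≤ r) (h2 : r ≤ n) :
    benenti n r (k+1) q = benenti n (r+1) k q - qc n q r * benenti n 1 k q := by
  by_cases hk : 0 ≤ k
  · rw [benenti, if_neg (by omega), if_neg (by omega), if_pos (by omega)]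
    simp
  · have e1 : benenti n 1 k q = - (1 / qc n q n) * benenti n n (k+1) q := by
      rw [benenti, if_neg (by omega), if_neg (by omega), if_neg (by omega),
        ben_out n (1-1) _ _ (by omega)]
      simp [qc]
    by_cases hr : r = n
    · rw [ben_out n (r+1) _ _ (by omega), e1, hr]
      field_simp
      ring
    · have e2 : benenti n (r+1) k q
          = benenti n r (k+1) q - qc n q r / qc n q n * benenti n n (k+1) q := by
        rw [benenti, if_neg (by omega), if_neg (by omega), if_neg (by omega)]
        simp
      rw [e1, e2]; ring

theorem ben_sum (n : ℕ) (k : ℤ) (q : Fin n → ℝ) (hq : qc n q n ≠ 0) (m : ℕ) (hm : m ≤ n) :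
    ∑ j ∈ Finset.range (m+1), qc n q j * benenti n 1 (k - j) q = benenti n (m+1) (k - m) q := by
  induction m with
  | zero => simp [qc]
  | succ m ih =>
    rw [Finset.sum_range_succ, ih (by omega)]
    have := ben_step n (m+1) (k - (m+1)) q hq (by omega) (by omega)
    have e : k - (m+1:ℤ) + 1 = k - m := by ring
    rw [e] at this
    push_cast
    rw [this]; ring

theorem ben_rec (n : ℕ) (k : ℤ) (q : Fin n → ℝ) (hq : qc n q n ≠ 0) :
    ∑ j ∈ Finset.range (n+1), qc n q j * benenti n 1 (k - j) q = 0 := by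
  rw [ben_sum n k q hq n le_rfl, ben_out]; omega

theorem ben_init (n : ℕ) (q : Fin n → ℝ) (k : ℕ) : ∀ r : ℤ, 1 ≤ r → r + k ≤ n →
    benenti n r k q = if r + k = n then 1 else 0 := by
  induction k with
  | zero =>
    intro r h1 h2
    rw [benenti, if_neg (by push_cast at h2; omega)]; simp
  | succ k ih =>
    intro r h1 h2
    push_cast at h2
    rw [benenti, if_neg (by omega), if_neg (by push_cast; omega), if_pos (by push_cast; omega)]
    have e : ((k+1:ℕ):ℤ) - 1 = k := by push_cast; ring
    rw [e, ih (r+1) (by omega) (by omega), ih 1 (by omega) (by omega),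
      if_neg (c := (1:ℤ) + k = n) (by omega)]
    push_cast
    have e2 : r + 1 + (k:ℤ) = r + (k + 1) := by ring
    rw [e2]; simp

theorem qc_deriv (n : ℕ) (q : Fin n → ℝ) (i : Fin n) (r : ℤ) (t : ℝ) :
    HasDerivAt (fun t => qc n (Function.update q i t) r) (if r = (i:ℕ) + 1 then 1 else 0) t := by
  unfold qc
  by_cases h0 : r = 0
  · simp only [h0, if_true]
    rw [if_neg (by omega)]
    exact hasDerivAt_const _ _
  · simp only [h0, if_false]
    by_cases h : 1 ≤ r ∧ r ≤ (n:ℤ)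
    · simp only [h, and_self, dite_true]
      by_cases hi : r = (i:ℕ) + 1
      · have : (⟨(r-1).toNat, by omega⟩ : Fin n) = i := by ext; simp; omega
        simp only [this, Function.update_self, if_pos hi]
        exact hasDerivAt_id' t
      · have : (⟨(r-1).toNat, by omega⟩ : Fin n) ≠ i := by
          intro hh; apply hi; have := congrArg Fin.val hh; simp at this; omega
        simp only [Function.update_of_ne this, if_neg hi]
        exact hasDerivAt_const _ _
    · simp only [h, dite_false]
      rw [if_neg (by have := i.2; omega)]
      exact hasDerivAt_const _ _

theorem ben_diff (n : ℕ) (q : Fin n → ℝ) (hq : qc n q n ≠ 0) (i : Fin n) (m : ℕ) :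
    ∀ r k : ℤ, k.natAbs = m →
      DifferentiableAt ℝ (fun t => benenti n r k (Function.update q i t)) (q i) := by
  induction m with
  | zero =>
    intro r k hk
    have : k = 0 := by omega
    subst this
    have : (fun t => benenti n r 0 (Function.update q i t)) = fun _ => benenti n r 0 q := by
      funext t; rw [benenti]; conv_rhs => rw [benenti]
      simp
    rw [this]; exact differentiableAt_const _
  | succ m ih =>
    intro r k hk
    by_cases hr : r < 1 ∨ (n:ℤ) < r
    · simp only [ben_out n r k _ hr]; exact differentiableAt_const _
    · by_cases hp : 0 < k
      · have : (fun t => benenti n r k (Function.update q i t)) = fun t =>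
          benenti n (r + 1) (k - 1) (Function.update q i t) - qc n (Function.update q i t) r
            * benenti n 1 (k - 1) (Function.update q i t) := by
          funext t; rw [benenti, if_neg hr, if_neg (by omega), if_pos hp]
        rw [this]
        exact (ih _ _ (by omega)).sub ((qc_deriv n q i r _).differentiableAt.mul (ih _ _ (by omega)))
      · have : (fun t => benenti n r k (Function.update q i t)) = fun t =>
          benenti n (r - 1) (k + 1) (Function.update q i t) - (qc n (Function.update q i t) (r-1)
            / qc n (Function.update q i t) n) * benenti n n (k + 1) (Function.update q i t) := by
          funext t; rw [benenti, if_neg hr, if_neg (by omega), if_neg hp]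
        rw [this]
        refine (ih _ _ (by omega)).sub (((qc_deriv n q i _ _).differentiableAt.div
          (qc_deriv n q i _ _).differentiableAt ?_).mul (ih _ _ (by omega)))
        simpa using hq

theorem pd_rec (n : ℕ) (q : Fin n → ℝ) (hq : qc n q n ≠ 0) (i : Fin n) (k : ℤ) :
    ∑ j ∈ Finset.range (n+1), qc n q j * pd (benenti n 1 (k - j)) i q
      = - benenti n 1 (k - ((i:ℕ) + 1)) q := by
  have hd := HasDerivAt.fun_sum (u := Finset.range (n+1)) (x := q i)
    (A := fun (j:ℕ) t => qc n (Function.update q i t) j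
      * benenti n 1 (k - j) (Function.update q i t))
    (fun j _ => (qc_deriv n q i j (q i)).mul (ben_diff n q hq i _ 1 (k-j) rfl).hasDerivAt)
  have hev : (fun t => ∑ j ∈ Finset.range (n+1), qc n (Function.update q i t) j
      * benenti n 1 (k - j) (Function.update q i t)) =ᶠ[nhds (q i)] fun _ => (0:ℝ) := by
    have hc := (qc_deriv n q i n (q i)).continuousAt
    have := hc.eventually_ne (y := 0) (by simpa using hq)
    filter_upwards [this] with t ht
    exact ben_rec n k _ ht
  have h0 := hd.unique ((hasDerivAt_const (q i) (0:ℝ)).congr_of_eventuallyEq hev)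
  rw [Finset.sum_add_distrib] at h0
  simp only [Function.update_eq_self] at h0
  rw [Finset.sum_eq_single ((i:ℕ)+1)] at h0
  · simp only [pd]
    push_cast at h0
    simp only [if_true] at h0
    linarith
  · intro b _ hb
    rw [if_neg (by omega), zero_mul]
  · intro h; exact absurd (Finset.mem_range.2 (by omega)) h

theorem pd_init (n : ℕ) (q : Fin n → ℝ) (i : Fin n) (k : ℤ) (h0 : 0 ≤ k) (h : k < n) :
    pd (benenti n 1 k) i q = 0 := by
  obtain ⟨m, rfl⟩ := Int.eq_ofNat_of_zero_le h0
  unfold pd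
  have : (fun t => benenti n 1 m (Function.update q i t)) =
      fun _ => if (1:ℤ) + m = n then (1:ℝ) else 0 := by
    funext t; exact ben_init n _ m 1 le_rfl (by omega)
  rw [this]; simp

theorem shift_one (n : ℕ) (q : Fin n → ℝ) (hq : qc n q n ≠ 0) (i : ℕ) (hi : i + 1 < n) (k : ℤ) :
    pd (benenti n 1 k) ⟨i, by omega⟩ q = pd (benenti n 1 (k+1)) ⟨i+1, hi⟩ q := by
  rw [← sub_eq_zero]
  refine hom_zero n (by omega) (fun j => qc n q j)
    (fun k => pd (benenti n 1 k) ⟨i, by omega⟩ q - pd (benenti n 1 (k+1)) ⟨i+1, hi⟩ q)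
    (by simp [qc]) hq ?_ (-1) ?_ k
  · intro k
    have h1 := pd_rec n q hq ⟨i, by omega⟩ k
    have h2 := pd_rec n q hq ⟨i+1, hi⟩ (k+1)
    simp only [mul_sub, Finset.sum_sub_distrib]
    rw [h1]
    simp only [add_sub_right_comm k 1] at h2
    rw [h2]
    have e : k - (((i+1:ℕ):ℤ) + 1) + 1 = k - ((i:ℤ)+1) := by push_cast; ring
    rw [e]; ring
  · intro j hj0 hj
    have e : (-1 + j + 1 : ℤ) = j := by ring
    simp only [e]
    rw [pd_init n q _ j hj0 hj, sub_zero]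
    by_cases hj1 : 1 ≤ j
    · exact pd_init n q _ _ (by omega) (by omega)
    · have : j = 0 := by omega
      subst this
      have h := pd_rec n q hq ⟨i, by omega⟩ (n-1)
      rw [Finset.sum_range_succ, Finset.sum_eq_zero] at h
      · have e2 : (n:ℤ) - 1 - (((i:ℕ):ℤ) + 1) = ((n - 2 - i : ℕ):ℤ) := by omega
        have e3 : (n:ℤ) - 1 - n = -1 + 0 := by ring
        simp only [e2, e3] at h
        rw [ben_init n q _ 1 le_rfl (by omega), if_neg (by omega)] at h
        simpa [hq] using h
      · intro x hx
        rw [Finset.mem_range] at hx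
        rw [pd_init n q _ _ (by omega) (by omega), mul_zero]

theorem shift_many (n : ℕ) (q : Fin n → ℝ) (hq : qc n q n ≠ 0) (i α : ℕ) (hi : i + α < n) (k : ℤ) :
    pd (benenti n 1 k) ⟨i, by omega⟩ q = pd (benenti n 1 (k+α)) ⟨i+α, hi⟩ q := by
  induction α with
  | zero => simp
  | succ a ih =>
    rw [ih (by omega), shift_one n q hq (i+a) (by omega)]
    push_cast
    simp only [add_assoc]

/-- For every `α ∈ {1,…,n−1}`, `i ∈ {1,…,n−α}` and `k ∈ ℤ`, the Benenti
potentials satisfy `∂V₁^{(k)}/∂q_i = ∂V₁^{(k+α)}/∂q_{i+α}` on `U_n = {q : q_n ≠ 0}`. -/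
theorem benenti_potential_derivative_shift
    (n : ℕ) (hn : 1 ≤ n) (α : ℕ) (hα1 : 1 ≤ α) (hα2 : α ≤ n - 1)
    (i : ℕ) (hi1 : 1 ≤ i) (hi2 : i ≤ n - α) (k : ℤ)
    (q : Fin n → ℝ) (hq : q ⟨n - 1, by omega⟩ ≠ 0) :
    pd (benenti n 1 k) ⟨i - 1, by omega⟩ q
      = pd (benenti n 1 (k + α)) ⟨i + α - 1, by omega⟩ q := by
  have hq' : qc n q n ≠ 0 := by
    have e : (⟨((n:ℤ) - 1).toNat, by omega⟩ : Fin n) = ⟨n - 1, by omega⟩ := by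
      ext; simp
    unfold qc
    rw [if_neg (by omega), dif_pos ⟨by omega, le_rfl⟩, e]
    exact hq
  rw [shift_many n q hq' (i-1) α (by omega) k]
  congr 1
  ext
  simp only
  omega
end

section
/- Let G^{(0)} be the n×n matrix with entries G^{(0)}_{ij} = q_{i+j−n−1}, with the conventions q_0 = 1 and q_α = 0 for α < 0. Then for every m ∈ ℤ and every q ∈ U_n the matrix L^m·G^{(0)} is invertible, and the entries of its inverse g^{(m)} = (L^m G^{(0)})^{-1} are g^{(m)}_{ij} = V_1^{(2n−m−i−j)}(q) for all i,j ∈ {1,…,n}. -/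
open scoped BigOperators

/-- The matrix `G⁽⁰⁾` with entries `G⁽⁰⁾_{ij} = q_{i+j−n−1}` (1-based indices),
with the conventions `q₀ = 1` and `q_α = 0` for `α < 0`. -/
def G0 (n : ℕ) (q : Fin n → ℝ) : Matrix (Fin n) (Fin n) ℝ :=
  Matrix.of fun i j => qc n q (((i : ℕ) : ℤ) + 1 + ((j : ℕ) + 1) - (n : ℤ) - 1)

theorem bn_out (n : ℕ) (q : Fin n → ℝ) (r k : ℤ) (h : r < 1 ∨ (n : ℤ) < r) :
    benenti n r k q = 0 := by
  rw [benenti, if_pos h]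

theorem bn_zero (n : ℕ) (q : Fin n → ℝ) (r : ℤ) (h1 : 1 ≤ r) (h2 : r ≤ n) :
    benenti n r 0 q = if r = (n : ℤ) then 1 else 0 := by
  rw [benenti, if_neg (by omega), if_pos rfl]

theorem bn_pos (n : ℕ) (q : Fin n → ℝ) (r k : ℤ) (h1 : 1 ≤ r) (h2 : r ≤ n) (hk : 0 < k) :
    benenti n r k q = benenti n (r + 1) (k - 1) q - qc n q r * benenti n 1 (k - 1) q := by
  rw [benenti, if_neg (by omega), if_neg (by omega), if_pos hk]

theorem bn_neg (n : ℕ) (q : Fin n → ℝ) (r k : ℤ) (h1 : 1 ≤ r) (h2 : r ≤ n) (hk : k < 0) :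
    benenti n r k q = benenti n (r - 1) (k + 1) q
      - (qc n q (r - 1) / qc n q n) * benenti n n (k + 1) q := by
  rw [benenti, if_neg (by omega), if_neg (by omega), if_neg (by omega)]

theorem qc_zero (n : ℕ) (q : Fin n → ℝ) : qc n q 0 = 1 := by simp [qc]

theorem bn_rec (n : ℕ) (hn : 1 ≤ n) (q : Fin n → ℝ) (hq : qc n q n ≠ 0) (r k : ℤ)
    (h1 : 1 ≤ r) (h2 : r ≤ n) :
    benenti n (r + 1) k q = benenti n r (k + 1) q + qc n q r * benenti n 1 k q := by
  rcases lt_or_ge k 0 with hk | hk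
  · have e1 := bn_neg n q 1 k le_rfl (by omega) hk
    rw [bn_out n q (1 - 1) _ (by omega), sub_self, qc_zero] at e1
    rw [e1]
    rcases eq_or_lt_of_le h2 with h | h
    · rw [bn_out n q (r + 1) _ (by omega), h]
      field_simp
      ring
    · rw [bn_neg n q (r + 1) k (by omega) (by omega) hk, add_sub_cancel_right]
      ring
  · rw [bn_pos n q r (k + 1) h1 h2 (by omega), add_sub_cancel_right]
    ring

theorem bn_sum (n : ℕ) (hn : 1 ≤ n) (q : Fin n → ℝ) (hq : qc n q n ≠ 0) (N : ℤ)
    (r : ℕ) (hr : r ≤ n) :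
    ∑ l ∈ Finset.range (r + 1), qc n q l * benenti n 1 (N - l) q
      = benenti n (r + 1) (N - r) q := by
  induction r with
  | zero => simp [qc_zero]
  | succ r ih =>
    rw [Finset.sum_range_succ, ih (by omega)]
    have := bn_rec n hn q hq (r + 1) (N - (r + 1)) (by omega) (by omega)
    push_cast
    rw [this]
    congr 2
    ring

theorem bn_delta (n : ℕ) (hn : 1 ≤ n) (q : Fin n → ℝ) (k : ℕ) (hk : k < n) (r : ℤ)
    (h1 : 1 ≤ r) (h2 : r ≤ n) :
    benenti n r k q = if r = (n : ℤ) - k then 1 else 0 := by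
  induction k generalizing r with
  | zero => simpa using bn_zero n q r h1 h2
  | succ k ih =>
    rw [bn_pos n q r _ h1 h2 (by omega)]
    push_cast
    rw [add_sub_cancel_right, ih (by omega) 1 le_rfl (by omega), if_neg (by omega)]
    rcases eq_or_lt_of_le h2 with h | h
    · rw [bn_out n q (r + 1) _ (by omega), if_neg (by omega)]; simp
    · rw [ih (by omega) (r + 1) (by omega) (by omega)]
      simp only [mul_zero, sub_zero]
      congr 1
      apply propext
      omega

noncomputable def Hm (n : ℕ) (q : Fin n → ℝ) (m : ℤ) : Matrix (Fin n) (Fin n) ℝ :=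
  Matrix.of fun i j => benenti n 1 (2 * (n : ℤ) - m - ((i : ℕ) + 1) - ((j : ℕ) + 1)) q

theorem Hm_G0 (n : ℕ) (hn : 1 ≤ n) (q : Fin n → ℝ) (hq : qc n q n ≠ 0) :
    Hm n q 0 * G0 n q = 1 := by
  ext i j
  have hi := i.2
  have hj := j.2
  rw [Matrix.mul_apply, Matrix.one_apply]
  simp only [Hm, G0, Matrix.of_apply]
  rw [Fin.sum_univ_eq_sum_range (fun k => benenti n 1 (2 * (n : ℤ) - 0 - ((i : ℕ) + 1)
    - ((k : ℕ) + 1)) q * qc n q ((k : ℤ) + 1 + ((j : ℕ) + 1) - (n : ℤ) - 1)) n,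
    ← Finset.sum_range_reflect]
  have hs : Finset.range ((j : ℕ) + 1) ⊆ Finset.range n := by
    intro x; simp only [Finset.mem_range]; omega
  rw [← Finset.sum_subset hs]
  · rw [← Finset.sum_range_reflect]
    have := bn_sum n hn q hq ((n : ℤ) - i - 1 + j) j (by omega)
    have e : ((n : ℤ) - i - 1 + j - j) = ((n - i - 1 : ℕ) : ℤ) := by omega
    rw [e, bn_delta n hn q _ (by omega) _ (by omega) (by omega)] at this
    have e2 : (i = j) ↔ ((j : ℕ) : ℤ) + 1 = (n : ℤ) - ((n - i - 1 : ℕ) : ℤ) := by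
      rw [Fin.ext_iff]; omega
    simp only [e2]
    rw [← this]
    apply Finset.sum_congr rfl
    intro x hx
    rw [Finset.mem_range] at hx
    rw [mul_comm]
    congr 2 <;> omega
  · intro x hx hx'
    simp only [Finset.mem_range] at hx hx'
    have : qc n q (((n - 1 - x : ℕ) : ℤ) + 1 + ((j : ℕ) + 1) - (n : ℤ) - 1) = 0 := by
      rw [qc, if_neg (by omega), dif_neg (by omega)]
    rw [this, mul_zero]

theorem qc_succ (n : ℕ) (q : Fin n → ℝ) (k : Fin n) : qc n q ((k : ℕ) + 1) = q k := by
  have := k.2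
  rw [qc, if_neg (by omega), dif_pos (by omega)]
  congr 1
  ext
  simp

theorem Hm_L (n : ℕ) (hn : 1 ≤ n) (q : Fin n → ℝ) (hq : qc n q n ≠ 0) (m : ℤ) :
    Hm n q (m + 1) * Lmat n q = Hm n q m := by
  ext i j
  have hj := j.2
  rw [Matrix.mul_apply]
  simp only [Hm, Lmat, Matrix.of_apply]
  by_cases h0 : (j : ℕ) = 0
  · simp only [h0, if_true]
    have := bn_sum n hn q hq (2 * n - m - (i + 1) - 1) n le_rfl
    rw [bn_out n q _ _ (by omega), Finset.sum_range_succ'] at this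
    simp only [← qc_succ n q]
    rw [Fin.sum_univ_eq_sum_range (fun k => benenti n 1 (2 * (n : ℤ) - (m + 1) - ((i : ℕ) + 1)
      - ((k : ℕ) + 1)) q * -qc n q ((k : ℤ) + 1)) n]
    simp only [Nat.cast_zero, qc_zero, sub_zero, one_mul] at this
    simp only [mul_neg, Finset.sum_neg_distrib, Nat.cast_zero, zero_add]
    rw [← sub_eq_zero, ← neg_eq_zero, ← this, neg_sub, sub_neg_eq_add, add_comm]
    congr 1
    apply Finset.sum_congr rfl
    intro x hx
    rw [mul_comm]
    push_cast
    congr 2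
    ring
  · simp only [h0, if_false]
    rw [Finset.sum_eq_single (⟨j - 1, by omega⟩ : Fin n)]
    · rw [if_pos (by simp only; omega), mul_one]
      congr 1
      simp only
      omega
    · intro b _ hb
      rw [if_neg, mul_zero]
      intro h
      apply hb
      ext
      simp only
      omega
    · simp

theorem Hm_zpow (n : ℕ) (hn : 1 ≤ n) (q : Fin n → ℝ) (hq : qc n q n ≠ 0) (m : ℤ) :
    Hm n q m * Lmat n q ^ m = Hm n q 0 := by
  have hu : IsUnit (Lmat n q).det := by
    have : (G0 n q * Hm n q 1) * Lmat n q = 1 := by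
      have h := Hm_L n hn q hq 0
      rw [zero_add] at h
      rw [Matrix.mul_assoc, h]
      exact mul_eq_one_comm.mp (Hm_G0 n hn q hq)
    exact Matrix.isUnit_det_of_left_inverse this
  have step : ∀ m : ℤ, Hm n q (m + 1) * Lmat n q ^ (m + 1) = Hm n q m * Lmat n q ^ m := by
    intro m
    rw [add_comm m 1, Matrix.zpow_one_add hu, ← Matrix.mul_assoc, add_comm 1 m,
      Hm_L n hn q hq]
  induction m with
  | zero => simp
  | succ k ih => rw [step, ih]
  | pred k ih => rw [← ih, ← step, sub_add_cancel]

/-- for every `m ∈ ℤ` and every `q` with `q_n ≠ 0`, the matrix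
`L^m·G⁽⁰⁾` is invertible and the entries of its inverse `g⁽ᵐ⁾ = (L^m G⁽⁰⁾)⁻¹` are
`g⁽ᵐ⁾_{ij} = V₁^{(2n−m−i−j)}(q)`. -/
theorem benenti_metric_entries (n : ℕ) (hn : 1 ≤ n) (m : ℤ)
    (q : Fin n → ℝ) (hq : q ⟨n - 1, by omega⟩ ≠ 0) :
    IsUnit (Lmat n q ^ m * G0 n q)
      ∧ ∀ i j : Fin n,
        (Lmat n q ^ m * G0 n q)⁻¹ i j
          = benenti n 1 (2 * (n : ℤ) - m - ((i : ℕ) + 1) - ((j : ℕ) + 1)) q := by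
  have hq' : qc n q n ≠ 0 := by
    have := qc_succ n q ⟨n - 1, by omega⟩
    have e : (((n - 1 : ℕ) : ℤ) + 1) = n := by omega
    simp only [e] at this
    rw [this]
    exact hq
  have key : Hm n q m * (Lmat n q ^ m * G0 n q) = 1 := by
    rw [← Matrix.mul_assoc, Hm_zpow n hn q hq', Hm_G0 n hn q hq']
  refine ⟨IsUnit.of_mul_eq_one_right _ key, ?_⟩
  intro i j
  rw [Matrix.inv_eq_left_inv key]
  rfl
end

section
/- For every σ ∈ {1,…,n−1}, every l ∈ {σ+1,…,n}, every smooth curve Q = (q_1,…,q_{n+1}) : ℝ → ℝ^{n+1} and every x ∈ ℝ: E_{l+1}(L^{n+1,0,2n+σ+2})[Q](x) = E_l(L^{n,0,2n+σ})[(q_1,…,q_n)](x), where on the left the Lagrangian density is built from the Benenti potentials in n+1 variables and on the right from those in n variables. -/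
open scoped BigOperators

noncomputable def hh (a : ℕ → ℝ) : ℕ → ℝ
  | 0 => 1
  | (s + 1) => - ∑ j : Fin (s + 1), a (j + 1) * hh a (s - j)
termination_by s => s
decreasing_by omega

noncomputable def hZ (a : ℕ → ℝ) (s : ℤ) : ℝ := if s < 0 then 0 else hh a s.toNat

noncomputable def gZ (a : ℕ → ℝ) (s : ℤ) : ℝ :=
  if s < 0 then 0 else ∑ x ∈ Finset.HasAntidiagonal.antidiagonal s.toNat, hh a x.1 * hh a x.2

theorem hh_zero (a : ℕ → ℝ) : hh a 0 = 1 := by rw [hh]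

theorem hh_succ (a : ℕ → ℝ) (s : ℕ) :
    hh a (s + 1) = - ∑ j ∈ Finset.range (s + 1), a (j + 1) * hh a (s - j) := by
  rw [hh, Finset.sum_range]

theorem hh_rec (a : ℕ → ℝ) (h0 : a 0 = 1) (s : ℕ) :
    ∑ j ∈ Finset.range (s + 2), a j * hh a (s + 1 - j) = 0 := by
  rw [Finset.sum_range_succ']
  simp only [Nat.sub_zero, h0, one_mul]
  rw [hh_succ]
  simp

theorem hh_congr (a b : ℕ → ℝ) (s : ℕ) (h : ∀ j, 1 ≤ j → j ≤ s → a j = b j) :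
    hh a s = hh b s := by
  induction s using Nat.strong_induction_on with
  | _ s ih =>
    cases s with
    | zero => simp [hh_zero]
    | succ s =>
      rw [hh_succ, hh_succ]
      congr 1
      refine Finset.sum_congr rfl fun j hj => ?_
      have := Finset.mem_range.1 hj
      rw [h (j + 1) (by omega) (by omega), ih (s - j) (by omega)
        (fun i h1 h2 => h i h1 (by omega))]

theorem hZ_congr (a b : ℕ → ℝ) (s : ℤ) (h : ∀ j : ℕ, 1 ≤ j → (j : ℤ) ≤ s → a j = b j) :
    hZ a s = hZ b s := by
  unfold hZ
  split_ifs with hs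
  · rfl
  · exact hh_congr _ _ _ fun j h1 h2 => h j h1 (by omega)

theorem gZ_congr (a b : ℕ → ℝ) (s : ℤ) (h : ∀ j : ℕ, 1 ≤ j → (j : ℤ) ≤ s → a j = b j) :
    gZ a s = gZ b s := by
  unfold gZ
  split_ifs with hs
  · rfl
  · refine Finset.sum_congr rfl fun x hx => ?_
    have := Finset.HasAntidiagonal.mem_antidiagonal.1 hx
    rw [hh_congr a b x.1 fun j h1 h2 => h j h1 (by omega),
      hh_congr a b x.2 fun j h1 h2 => h j h1 (by omega)]

theorem hh_series (a : ℕ → ℝ) (h0 : a 0 = 1) :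
    PowerSeries.mk a * PowerSeries.mk (hh a) = 1 := by
  ext s
  rw [PowerSeries.coeff_mul, PowerSeries.coeff_one]
  simp only [PowerSeries.coeff_mk]
  rw [Finset.Nat.sum_antidiagonal_eq_sum_range_succ (fun i j => a i * hh a j)]
  cases s with
  | zero => simp [h0, hh_zero]
  | succ s => simpa using hh_rec a h0 s

theorem hh_cont (a : ℕ → ℝ) (l : ℕ) (s : ℕ) :
    Continuous fun t => hh (Function.update a l t) s := by
  induction s using Nat.strong_induction_on with
  | _ s ih =>
    cases s with
    | zero => simp only [hh_zero]; fun_prop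
    | succ s =>
      simp only [hh_succ]
      refine Continuous.neg (continuous_finsetSum _ fun j hj => ?_)
      refine Continuous.mul ?_ (ih _ (by omega))
      by_cases h : j + 1 = l
      · subst h; simpa using continuous_id'
      · simp only [Function.update_of_ne h]; fun_prop

theorem hh_diff (a : ℕ → ℝ) (h0 : a 0 = 1) (l : ℕ) (hl : 1 ≤ l) (t : ℝ) (s : ℕ) :
    hh (Function.update a l t) s = hh a s + (t - a l) *
      (if s < l then 0 else
        - ∑ x ∈ Finset.HasAntidiagonal.antidiagonal (s - l), hh a x.1 * hh (Function.update a l t) x.2) := by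
  set b := Function.update a l t with hb
  have hb0 : b 0 = 1 := by rw [hb, Function.update_of_ne (by omega), h0]
  have hA := hh_series a h0
  have hB := hh_series b hb0
  have hAB : PowerSeries.mk b = PowerSeries.mk a
      + PowerSeries.X ^ l * PowerSeries.C (t - a l) := by
    ext s
    simp only [map_add, PowerSeries.coeff_mk, PowerSeries.coeff_mul_C, PowerSeries.coeff_X_pow]
    by_cases h : s = l
    · subst h; simp [hb]
    · simp [hb, h]
  have key : PowerSeries.mk (hh b) = PowerSeries.mk (hh a)
      - PowerSeries.X ^ l * (PowerSeries.C (t - a l) *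
        (PowerSeries.mk (hh a) * PowerSeries.mk (hh b))) := by
    rw [hAB] at hB
    linear_combination (PowerSeries.mk (hh a)) * hB - (PowerSeries.mk (hh b)) * hA
  have := congrArg (PowerSeries.coeff s) key
  rw [map_sub, PowerSeries.coeff_X_pow_mul', PowerSeries.coeff_C_mul,
    PowerSeries.coeff_mul] at this
  simp only [PowerSeries.coeff_mk] at this
  rw [this]
  by_cases h : s < l
  · simp [h, not_le.2 h]
  · rw [if_neg h, if_pos (not_lt.1 h)]; ring

theorem hZ_deriv (a : ℕ → ℝ) (h0 : a 0 = 1) (l : ℕ) (hl : 1 ≤ l) (s : ℤ) :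
    HasDerivAt (fun t => hZ (Function.update a l t) s) (- gZ a (s - l)) (a l) := by
  by_cases hs : s < 0
  · simp only [hZ, hs, if_true, gZ]
    rw [if_pos (by omega)]
    simpa using hasDerivAt_const (a l) (0 : ℝ)
  obtain ⟨s, rfl⟩ := Int.eq_ofNat_of_zero_le (not_lt.1 hs)
  simp only [hZ, hs, if_false, Int.toNat_natCast]
  set φ : ℝ → ℝ := fun t => (if s < l then 0 else
        - ∑ x ∈ Finset.HasAntidiagonal.antidiagonal (s - l), hh a x.1 * hh (Function.update a l t) x.2) with hφ
  have hc : Continuous φ := by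
    rw [hφ]
    split_ifs
    · fun_prop
    · exact (continuous_finsetSum _ fun x _ => continuous_const.mul (hh_cont a l x.2)).neg
  have hv : φ (a l) = - gZ a ((s : ℤ) - l) := by
    simp only [hφ, gZ, Function.update_eq_self]
    by_cases h : s < l
    · rw [if_pos h, if_pos (by omega)]; simp
    · rw [if_neg h, if_neg (by omega)]
      congr 3
      omega
  rw [← hv, hasDerivAt_iff_tendsto_slope]
  refine ((hc.tendsto (a l)).mono_left nhdsWithin_le_nhds).congr' ?_
  filter_upwards [self_mem_nhdsWithin] with t ht
  have ht' : t - a l ≠ 0 := sub_ne_zero.2 ht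
  rw [slope_def_field, Function.update_eq_self, hh_diff a h0 l hl t s]
  field_simp
  ring

/-- coordinates as a sequence -/
noncomputable def qs (n : ℕ) (q : Fin n → ℝ) (j : ℕ) : ℝ := qc n q j

theorem qs_zero (n : ℕ) (q : Fin n → ℝ) : qs n q 0 = 1 := by simp [qs, qc]

theorem qs_succ (n : ℕ) (q : Fin n → ℝ) (i : Fin n) : qs n q (i + 1) = q i := by
  have := i.2
  unfold qs qc
  rw [if_neg (by omega), dif_pos (by omega)]
  congr 1
  ext
  simp

theorem qs_big (n : ℕ) (q : Fin n → ℝ) (j : ℕ) (h : n < j) : qs n q j = 0 := by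
  unfold qs qc
  rw [if_neg (by omega), dif_neg (by omega)]

theorem qs_update (n : ℕ) (q : Fin n → ℝ) (l : Fin n) (t : ℝ) :
    qs n (Function.update q l t) = Function.update (qs n q) (l + 1) t := by
  ext j
  rcases j with _ | j
  · rw [Function.update_of_ne (by omega), qs_zero, qs_zero]
  by_cases hj : j < n
  · have e := qs_succ n q ⟨j, hj⟩
    have e' := qs_succ n (Function.update q l t) ⟨j, hj⟩
    simp only at e e'
    rw [e']
    by_cases h : l = ⟨j, hj⟩
    · subst h; simp
    · have : j + 1 ≠ (l : ℕ) + 1 := fun h' => h (Fin.ext (by simp; omega))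
      rw [Function.update_of_ne (Ne.symm h), Function.update_of_ne this, e]
  · have := l.2
    rw [Function.update_of_ne (by omega), qs_big _ _ _ (by omega), qs_big _ _ _ (by omega)]

theorem hZ_neg (a : ℕ → ℝ) (s : ℤ) (h : s < 0) : hZ a s = 0 := by simp [hZ, h]

theorem gZ_neg (a : ℕ → ℝ) (s : ℤ) (h : s < 0) : gZ a s = 0 := by simp [gZ, h]

theorem hZ_rec (n : ℕ) (q : Fin n → ℝ) (k : ℕ) :
    ∑ j ∈ Finset.range (n + 1), qs n q j * hZ (qs n q) ((k : ℤ) + 1 - j) = 0 := by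
  have h := hh_rec (qs n q) (qs_zero n q) k
  have h1 : ∑ j ∈ Finset.range (n + 1), qs n q j * hZ (qs n q) ((k : ℤ) + 1 - j)
      = ∑ j ∈ Finset.range (n + k + 2), qs n q j * hZ (qs n q) ((k : ℤ) + 1 - j) := by
    refine Finset.sum_subset (fun j hj => ?_) fun j _ hj => ?_
    · simp only [Finset.mem_range] at *; omega
    · simp only [Finset.mem_range] at *
      rw [qs_big _ _ _ (by omega), zero_mul]
  have h2 : ∑ j ∈ Finset.range (k + 2), qs n q j * hZ (qs n q) ((k : ℤ) + 1 - j)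
      = ∑ j ∈ Finset.range (n + k + 2), qs n q j * hZ (qs n q) ((k : ℤ) + 1 - j) := by
    refine Finset.sum_subset (fun j hj => ?_) fun j _ hj => ?_
    · simp only [Finset.mem_range] at *; omega
    · simp only [Finset.mem_range] at *
      rw [hZ_neg _ _ (by omega), mul_zero]
  rw [h1, ← h2, ← h]
  refine Finset.sum_congr rfl fun j hj => ?_
  simp only [Finset.mem_range] at hj
  unfold hZ
  rw [if_neg (by omega)]
  congr 2
  omega

theorem benenti_eq (n : ℕ) (q : Fin n → ℝ) (k : ℕ) : ∀ r : ℕ, 1 ≤ r → r ≤ n →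
    benenti n r k q = ∑ j ∈ Finset.range r, qs n q j * hZ (qs n q) ((k : ℤ) + r - n - j) := by
  induction k with
  | zero =>
    intro r h1 h2
    rw [benenti, if_neg (by omega), if_pos (by simp)]
    obtain ⟨r, rfl⟩ : ∃ r', r = r' + 1 := ⟨r - 1, by omega⟩
    rw [Finset.sum_range_succ', Finset.sum_eq_zero, qs_zero]
    · by_cases h : r + 1 = n
      · rw [if_pos (by omega)]
        simp only [hZ]
        rw [if_neg (by omega)]
        have : (((0 : ℕ) : ℤ) + ((r + 1 : ℕ) : ℤ) - (n : ℤ) - ((0 : ℕ) : ℤ)).toNat = 0 := by omega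
        rw [this, hh_zero]; simp
      · rw [if_neg (by omega), hZ_neg _ _ (by omega)]; simp
    · intro j hj
      rw [hZ_neg _ _ (by omega), mul_zero]
  | succ k ih =>
    intro r h1 h2
    rw [benenti, if_neg (by omega), if_neg (by omega), if_pos (by omega)]
    have e1 : (((k + 1 : ℕ) : ℤ) - 1) = (k : ℤ) := by omega
    have i1 := ih 1 le_rfl (by omega)
    rw [Finset.sum_range_one, qs_zero, one_mul] at i1
    have e2 : qc n q (r : ℤ) = qs n q r := rfl
    rw [e1, e2]
    rw [Nat.cast_one] at i1
    rw [i1]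
    have key : benenti n ((r : ℤ) + 1) k q = ∑ j ∈ Finset.range (r + 1),
        qs n q j * hZ (qs n q) (((k + 1 : ℕ) : ℤ) + r - n - j) := by
      by_cases h : r = n
      · subst h
        rw [benenti, if_pos (by omega), ← hZ_rec r q k]
        refine Finset.sum_congr rfl fun j _ => ?_
        congr 2
        push_cast
        ring
      · have := ih (r + 1) (by omega) (by omega)
        push_cast at this
        rw [this]
        refine Finset.sum_congr rfl fun j _ => ?_
        congr 2
        push_cast
        ring
    rw [key, Finset.sum_range_succ]
    have : ((k : ℤ) + 1 - n - (0 : ℕ)) = (((k + 1 : ℕ) : ℤ) + r - n - r) := by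
      push_cast; ring
    rw [this]
    ring

theorem benenti_one (n : ℕ) (hn : 1 ≤ n) (q : Fin n → ℝ) (k : ℤ) (hk : 0 ≤ k) :
    benenti n 1 k q = hZ (qs n q) (k + 1 - n) := by
  obtain ⟨k, rfl⟩ := Int.eq_ofNat_of_zero_le hk
  have := benenti_eq n q k 1 le_rfl hn
  simpa [qs_zero] using this

theorem lag_eq (n : ℕ) (hn : 1 ≤ n) (k : ℤ) (hk : 0 ≤ k) (q p : Fin n → ℝ) :
    lag n 0 k q p = (1 / 2) * ∑ i : Fin n, ∑ j : Fin n,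
      hZ (qs n q) ((n : ℤ) - 1 - (i : ℕ) - (j : ℕ)) * p i * p j
      - hZ (qs n q) (k + 1 - n) := by
  unfold lag
  rw [benenti_one n hn q k hk]
  congr 2
  refine Finset.sum_congr rfl fun i _ => Finset.sum_congr rfl fun j _ => ?_
  have := i.2
  have := j.2
  rw [benenti_one n hn q _ (by omega)]
  congr 3
  ring

theorem pd_q (n : ℕ) (hn : 1 ≤ n) (k : ℤ) (hk : 0 ≤ k) (q p : Fin n → ℝ) (l : Fin n) :
    pd (fun vq => lag n 0 k vq p) l q = (1 / 2) * ∑ i : Fin n, ∑ j : Fin n,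
      (- gZ (qs n q) ((n : ℤ) - 1 - (i : ℕ) - (j : ℕ) - ((l : ℕ) + 1 : ℕ))) * p i * p j
      - (- gZ (qs n q) (k + 1 - n - ((l : ℕ) + 1 : ℕ))) := by
  unfold pd
  simp only [lag_eq n hn k hk, qs_update]
  have D := fun s => hZ_deriv (qs n q) (qs_zero n q) (l + 1) (by omega) s
  rw [qs_succ] at D
  refine HasDerivAt.deriv (HasDerivAt.sub (HasDerivAt.const_mul _ ?_) (D _))
  exact HasDerivAt.fun_sum fun i _ => HasDerivAt.fun_sum fun j _ =>
    ((D _).mul_const _).mul_const _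

theorem pd_p (n : ℕ) (hn : 1 ≤ n) (k : ℤ) (hk : 0 ≤ k) (q p : Fin n → ℝ) (l : Fin n) :
    pd (fun vp => lag n 0 k q vp) l p = ∑ j : Fin n,
      hZ (qs n q) ((n : ℤ) - 1 - (l : ℕ) - (j : ℕ)) * p j := by
  unfold pd
  simp only [lag_eq n hn k hk]
  have D : ∀ i : Fin n, HasDerivAt (fun t => Function.update p l t i)
      (if i = l then 1 else 0) (p l) := by
    intro i
    by_cases h : i = l
    · subst h; simpa using hasDerivAt_id' _
    · simp only [Function.update_of_ne h, if_neg h]; exact hasDerivAt_const _ _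
  have E : HasDerivAt (fun t => (1 / 2) * ∑ i : Fin n, ∑ j : Fin n,
      hZ (qs n q) ((n : ℤ) - 1 - (i : ℕ) - (j : ℕ)) * Function.update p l t i
        * Function.update p l t j - hZ (qs n q) (k + 1 - n))
      ((1 / 2) * ∑ i : Fin n, ∑ j : Fin n,
        (hZ (qs n q) ((n : ℤ) - 1 - (i : ℕ) - (j : ℕ)) * (if i = l then 1 else 0)
          * Function.update p l (p l) j
        + hZ (qs n q) ((n : ℤ) - 1 - (i : ℕ) - (j : ℕ)) * Function.update p l (p l) i
          * (if j = l then 1 else 0))) (p l) := by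
    refine HasDerivAt.sub_const _ (HasDerivAt.const_mul _ ?_)
    refine HasDerivAt.fun_sum fun i _ => HasDerivAt.fun_sum fun j _ => ?_
    exact ((D i).const_mul _).fun_mul (D j)
  rw [E.deriv]
  simp only [Function.update_eq_self, Finset.sum_add_distrib, mul_ite, mul_one, mul_zero,
    ite_mul, zero_mul, Finset.sum_ite_eq', Finset.mem_univ, if_true]
  rw [Finset.sum_comm]
  simp only [Finset.sum_ite_eq', Finset.mem_univ, if_true]
  have : ∑ i : Fin n, hZ (qs n q) ((n : ℤ) - 1 - (i : ℕ) - (l : ℕ)) * p i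
      = ∑ i : Fin n, hZ (qs n q) ((n : ℤ) - 1 - (l : ℕ) - (i : ℕ)) * p i := by
    refine Finset.sum_congr rfl fun i _ => ?_
    congr 2
    ring
  rw [this]
  ring

theorem qs_castSucc (n : ℕ) (q : Fin (n + 1) → ℝ) (j : ℕ) (hj : j ≤ n) :
    qs (n + 1) q j = qs n (fun i => q i.castSucc) j := by
  rcases j with _ | j
  · rw [qs_zero, qs_zero]
  · have e := qs_succ (n + 1) q ⟨j, by omega⟩
    have e' := qs_succ n (fun i => q i.castSucc) ⟨j, by omega⟩
    simp only at e e'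
    rw [e, e']
    rfl



/-- for every `σ ∈ {1,…,n−1}`, `l ∈ {σ+1,…,n}`, every smooth curve
`Q = (q₁,…,q_{n+1})` and every `x`:
`E_{l+1}(L^{n+1,0,2n+σ+2})[Q](x) = E_l(L^{n,0,2n+σ})[(q₁,…,q_n)](x)`. -/
theorem el_positive_stabilization
    (n : ℕ) (hn : 1 ≤ n) (σ : ℕ) (hσ1 : 1 ≤ σ) (hσ2 : σ ≤ n - 1)
    (l : ℕ) (hl1 : σ + 1 ≤ l) (hl2 : l ≤ n)
    (Q : ℝ → Fin (n + 1) → ℝ) (hQ : ContDiff ℝ (⊤ : ℕ∞) Q) (x : ℝ) :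
    elExpr (lag (n + 1) 0 (2 * (n : ℤ) + σ + 2)) ⟨l, by omega⟩ Q x
      = elExpr (lag n 0 (2 * (n : ℤ) + σ)) ⟨l - 1, by omega⟩
          (fun y i => Q y i.castSucc) x := by

  have hder : ∀ y, deriv (fun y (i : Fin n) => Q y i.castSucc) y
      = fun i => deriv Q y i.castSucc := by
    intro y
    have hd : DifferentiableAt ℝ Q y := (hQ.differentiable (by simp)).differentiableAt
    have h1 := hasDerivAt_pi.1 hd.hasDerivAt
    exact (hasDerivAt_pi.2 fun i : Fin n => h1 i.castSucc).deriv
  have hH : ∀ y (s : ℤ), s ≤ n → hZ (qs (n + 1) (Q y)) s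
      = hZ (qs n (fun i => Q y i.castSucc)) s := fun y s hs =>
    hZ_congr _ _ _ fun j _ h2 => qs_castSucc n (Q y) j (by omega)
  have hG : ∀ y (s : ℤ), s ≤ n → gZ (qs (n + 1) (Q y)) s
      = gZ (qs n (fun i => Q y i.castSucc)) s := fun y s hs =>
    gZ_congr _ _ _ fun j _ h2 => qs_castSucc n (Q y) j (by omega)
  unfold elExpr
  congr 1
  · rw [pd_q (n + 1) (by omega) _ (by omega), pd_q n hn _ (by omega), hder]
    congr 1
    · congr 1
      rw [Fin.sum_univ_castSucc, Finset.sum_eq_zero (s := (Finset.univ : Finset (Fin (n + 1))))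
        (f := fun j => _ * deriv Q x (Fin.last n) * deriv Q x j), add_zero]
      · refine Finset.sum_congr rfl fun i _ => ?_
        rw [Fin.sum_univ_castSucc, gZ_neg _ _ (by simp <;> omega), neg_zero, zero_mul, zero_mul,
          add_zero]
        refine Finset.sum_congr rfl fun j _ => ?_
        rw [hG _ _ (by simp <;> omega)]
        congr 4
        simp <;> omega
      · intro j _
        rw [gZ_neg _ _ (by simp <;> omega), neg_zero, zero_mul, zero_mul]
    · rw [hG _ _ (by push_cast; omega)]
      congr 2
      push_cast
      try omega
  · congr 1
    funext y
    rw [pd_p (n + 1) (by omega) _ (by omega), pd_p n hn _ (by omega), hder,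
      Fin.sum_univ_castSucc, hZ_neg _ _ (by simp <;> omega), zero_mul, add_zero]
    refine Finset.sum_congr rfl fun j _ => ?_
    rw [hH _ _ (by simp <;> omega)]
    congr 2
    simp
    omega
end

section
/- For every σ ∈ {1,…,n−1}, every l ∈ {1,…,σ}, every smooth curve Q = (q_1,…,q_{n+1}) : ℝ → ℝ^{n+1} with q_n and q_{n+1} nowhere zero, and every x ∈ ℝ: E_l(L^{n,n−σ,0})[(q_1,…,q_n)](x) = E_l(L^{n+1,n+1−σ,0})[Q](x), where on the left the Lagrangian density is built from the Benenti potentials in n variables and on the right from those in n+1 variables. -/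
open scoped BigOperators

lemma ben_nonneg (n : ℕ) (q : Fin n → ℝ) (k : ℕ) : ∀ (r : ℤ), k < n → 1 ≤ r → r ≤ n →
    benenti n r k q = if r = (n : ℤ) - k then 1 else 0 := by
  induction k with
  | zero =>
    intro r hk h1 h2
    rw [benenti, if_neg (by omega)]
    simp
  | succ k ih =>
    intro r hk h1 h2
    rw [benenti, if_neg (by omega), if_neg (by omega), if_pos (by omega)]
    have e : ((k + 1 : ℕ) : ℤ) - 1 = k := by omega
    rw [e, ih 1 (by omega) (by omega) (by omega), if_neg (by omega)]
    by_cases hr : r = n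
    · rw [benenti, if_pos (by omega), if_neg (by omega)]; ring
    · rw [ih (r + 1) (by omega) (by omega) (by omega)]
      by_cases h : r = (n : ℤ) - (k + 1 : ℕ)
      · rw [if_pos (by omega), if_pos h]; ring
      · rw [if_neg (by omega), if_neg h]; ring

lemma qc_castSucc (n : ℕ) (Q : Fin (n + 1) → ℝ) (r : ℤ) (h1 : 1 ≤ r) (h2 : r ≤ n) :
    qc (n + 1) Q r = qc n (fun i => Q i.castSucc) r := by
  unfold qc
  rw [if_neg (by omega), if_neg (by omega), dif_pos (by omega), dif_pos (by omega)]
  rfl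

lemma ben_stab (n : ℕ) (hn : 1 ≤ n) (Q : Fin (n + 1) → ℝ) (s : ℕ) :
    ∀ (r : ℤ), 1 ≤ r → r ≤ (n : ℤ) - s →
    benenti (n + 1) r ((n : ℤ) + s) Q
      = benenti n r ((n : ℤ) - 1 + s) (fun i => Q i.castSucc) := by
  induction s with
  | zero =>
    intro r h1 h2
    have e1 : (n : ℤ) + (0 : ℕ) = (n : ℕ) := by omega
    have e2 : (n : ℤ) - 1 + (0 : ℕ) = (n - 1 : ℕ) := by omega
    rw [e1, e2, ben_nonneg _ _ _ _ (by omega) h1 (by push_cast; omega),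
      ben_nonneg _ _ _ _ (by omega) h1 (by omega)]
    congr 1
    apply propext
    omega
  | succ s ih =>
    intro r h1 h2
    rw [benenti, if_neg (by omega), if_neg (by omega), if_pos (by omega)]
    conv_rhs => rw [benenti, if_neg (by omega), if_neg (by omega), if_pos (by omega)]
    have e1 : (n : ℤ) + (s + 1 : ℕ) - 1 = n + s := by omega
    have e2 : (n : ℤ) - 1 + (s + 1 : ℕ) - 1 = n - 1 + s := by omega
    rw [e1, e2, ih (r + 1) (by omega) (by omega), ih 1 (by omega) (by omega),
      qc_castSucc n Q r h1 (by omega)]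

lemma qc_update (n : ℕ) (q : Fin n → ℝ) (l : Fin n) (t : ℝ) (r : ℤ) (h : (l : ℤ) + 1 < r) :
    qc n (Function.update q l t) r = qc n q r := by
  unfold qc
  split_ifs with h1 h2
  · rfl
  · rw [Function.update_of_ne]
    intro h3
    have := congrArg Fin.val h3
    simp only at this
    omega
  · rfl

lemma ben_neg (n : ℕ) (q : Fin n → ℝ) (l : Fin n) (t : ℝ) (k : ℕ) :
    ∀ (r : ℤ), r ≤ n → (l : ℤ) + 1 < r - k →
    benenti n r (-(k : ℤ)) (Function.update q l t) = benenti n r (-(k : ℤ)) q := by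
  induction k with
  | zero =>
    intro r h1 h2
    rw [benenti, if_neg (by omega), if_pos (by omega)]
    conv_rhs => rw [benenti, if_neg (by omega), if_pos (by omega)]
  | succ k ih =>
    intro r h1 h2
    rw [benenti, if_neg (by omega), if_neg (by omega), if_neg (by omega)]
    conv_rhs => rw [benenti, if_neg (by omega), if_neg (by omega), if_neg (by omega)]
    have e : -((k + 1 : ℕ) : ℤ) + 1 = -(k : ℤ) := by omega
    rw [e, ih (r - 1) (by omega) (by omega), ih n (by omega) (by omega),
      qc_update _ _ _ _ _ (by omega), qc_update _ _ _ _ _ (by omega)]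

lemma ben_neg_one (n : ℕ) (q : Fin n → ℝ) (l : Fin n) (t : ℝ) (k : ℕ) (hk : 1 ≤ k)
    (h : (l : ℤ) + k < n) :
    benenti n 1 (-(k : ℤ)) (Function.update q l t) = benenti n 1 (-(k : ℤ)) q := by
  rw [benenti, if_neg (by omega), if_neg (by omega), if_neg (by omega)]
  conv_rhs => rw [benenti, if_neg (by omega), if_neg (by omega), if_neg (by omega)]
  have e : -(k : ℤ) + 1 = -((k - 1 : ℕ) : ℤ) := by omega
  rw [e, ben_neg _ _ _ _ _ n (by omega) (by omega), qc_update _ _ _ _ n (by omega)]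
  have z : ∀ q : Fin n → ℝ, benenti n (1 - 1) (-((k - 1 : ℕ) : ℤ)) q = 0 := by
    intro q
    rw [benenti, if_pos (by omega)]
  have z' : ∀ q : Fin n → ℝ, qc n q (1 - 1) = 1 := by
    intro q
    simp [qc]
  rw [z, z, z', z']

noncomputable def stS (n σ : ℕ) (q p : Fin n → ℝ) : ℝ :=
  (1 / 2) * ∑ i : Fin n, ∑ j : Fin n, if (i : ℕ) + j < σ then
      benenti n 1 (2 * (n : ℤ) - ((n : ℤ) - σ) - ((i : ℕ) + 1) - ((j : ℕ) + 1)) q * p i * p j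
      else 0

noncomputable def stR (n σ : ℕ) (q p : Fin n → ℝ) : ℝ :=
  (1 / 2) * (∑ i : Fin n, ∑ j : Fin n, if (i : ℕ) + j < σ then 0 else
      benenti n 1 (2 * (n : ℤ) - ((n : ℤ) - σ) - ((i : ℕ) + 1) - ((j : ℕ) + 1)) q * p i * p j)
    - benenti n 1 0 q

lemma lag_split (n σ : ℕ) (q p : Fin n → ℝ) :
    lag n ((n : ℤ) - σ) 0 q p = stS n σ q p + stR n σ q p := by
  unfold lag stS stR
  rw [← add_sub_assoc, ← mul_add, ← Finset.sum_add_distrib]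
  congr 2
  refine Finset.sum_congr rfl fun i _ => ?_
  rw [← Finset.sum_add_distrib]
  refine Finset.sum_congr rfl fun j _ => ?_
  split_ifs <;> simp

lemma stR_update (n σ : ℕ) (hσ : σ < n) (l : Fin n) (hl : (l : ℕ) < σ)
    (q p : Fin n → ℝ) (t u : ℝ) :
    stR n σ (Function.update q l t) (Function.update p l u) = stR n σ q p := by
  unfold stR
  congr 1
  · congr 1
    refine Finset.sum_congr rfl fun i _ => Finset.sum_congr rfl fun j _ => ?_
    split_ifs with h
    · rfl
    have hi := i.2
    have hj := j.2
    by_cases h2 : (i : ℕ) + j ≤ n + σ - 2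
    · have e : 2 * (n : ℤ) - ((n : ℤ) - σ) - ((i : ℕ) + 1) - ((j : ℕ) + 1)
        = (n + σ - 2 - i - j : ℕ) := by omega
      rw [e, ben_nonneg _ _ _ _ (by omega) (by omega) (by omega),
        ben_nonneg _ _ _ _ (by omega) (by omega) (by omega), if_neg (by omega)]
      simp
    · have e : 2 * (n : ℤ) - ((n : ℤ) - σ) - ((i : ℕ) + 1) - ((j : ℕ) + 1)
        = -((i + j + 2 - n - σ : ℕ) : ℤ) := by omega
      rw [e, ben_neg_one _ _ _ _ _ (by omega) (by omega), Function.update_of_ne,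
        Function.update_of_ne]
      · intro h3
        have := congrArg Fin.val h3
        omega
      · intro h3
        have := congrArg Fin.val h3
        omega
  · have := ben_nonneg n (Function.update q l t) 0 1 (by omega) (by omega) (by omega)
    have h2 := ben_nonneg n q 0 1 (by omega) (by omega) (by omega)
    simp only [Nat.cast_zero] at this h2
    rw [this, h2]

lemma stS_succ (n σ : ℕ) (hσ : σ < n) (Q P : Fin (n + 1) → ℝ) :
    stS (n + 1) σ Q P = stS n σ (fun i => Q i.castSucc) (fun i => P i.castSucc) := by
  unfold stS
  congr 1
  rw [Fin.sum_univ_castSucc, Finset.sum_eq_zero (s := Finset.univ)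
    (f := fun j : Fin (n + 1) => if ((Fin.last n : Fin (n + 1)) : ℕ) + j < σ then _ else _), add_zero]
  · refine Finset.sum_congr rfl fun i _ => ?_
    rw [Fin.sum_univ_castSucc, if_neg (by simp; omega), add_zero]
    refine Finset.sum_congr rfl fun j _ => ?_
    simp only [Fin.val_castSucc]
    split_ifs with h
    · have e : 2 * ((n + 1 : ℕ) : ℤ) - (((n + 1 : ℕ) : ℤ) - σ) - ((i : ℕ) + 1) - ((j : ℕ) + 1)
        = (n : ℤ) + (σ - 1 - i - j : ℕ) := by omega
      have e' : 2 * (n : ℤ) - ((n : ℤ) - σ) - ((i : ℕ) + 1) - ((j : ℕ) + 1)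
        = (n : ℤ) - 1 + (σ - 1 - i - j : ℕ) := by omega
      rw [e, e', ben_stab n (by omega) Q _ 1 (by omega) (by omega)]
    · rfl
  · intro j _
    rw [if_neg (by simp; omega)]

lemma pd_q_s7 (n σ : ℕ) (hσ : σ < n) (l : Fin n) (hl : (l : ℕ) < σ) (q p : Fin n → ℝ) :
    pd (fun vq => lag n ((n : ℤ) - σ) 0 vq p) l q
      = deriv (fun t => stS n σ (Function.update q l t) p) (q l) := by
  unfold pd
  have : (fun t => lag n ((n : ℤ) - σ) 0 (Function.update q l t) p)
      = fun t => stS n σ (Function.update q l t) p + stR n σ q p := by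
    funext t
    have := stR_update n σ hσ l hl q p t (p l)
    rw [Function.update_eq_self] at this
    rw [lag_split, this]
  rw [this, deriv_add_const]

lemma pd_p_s7 (n σ : ℕ) (hσ : σ < n) (l : Fin n) (hl : (l : ℕ) < σ) (q p : Fin n → ℝ) :
    pd (fun vp => lag n ((n : ℤ) - σ) 0 q vp) l p
      = deriv (fun t => stS n σ q (Function.update p l t)) (p l) := by
  unfold pd
  have : (fun t => lag n ((n : ℤ) - σ) 0 q (Function.update p l t))
      = fun t => stS n σ q (Function.update p l t) + stR n σ q p := by
    funext t
    have := stR_update n σ hσ l hl q p (q l) t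
    rw [Function.update_eq_self] at this
    rw [lag_split, this]
  rw [this, deriv_add_const]

lemma upd_castSucc (n : ℕ) (l : Fin n) (Q : Fin (n + 1) → ℝ) (t : ℝ) :
    (fun i : Fin n => Function.update Q l.castSucc t i.castSucc)
      = Function.update (fun i : Fin n => Q i.castSucc) l t := by
  funext i
  simp [Function.update_apply]

/-- for every `σ ∈ {1,…,n−1}`, `l ∈ {1,…,σ}`, every smooth curve
`Q = (q₁,…,q_{n+1})` with `q_n` and `q_{n+1}` nowhere zero, and every `x`:
`E_l(L^{n,n−σ,0})[(q₁,…,q_n)](x) = E_l(L^{n+1,n+1−σ,0})[Q](x)`. -/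
theorem el_geodesic_stabilization
    (n : ℕ) (hn : 1 ≤ n) (σ : ℕ) (hσ1 : 1 ≤ σ) (hσ2 : σ ≤ n - 1)
    (l : ℕ) (hl1 : 1 ≤ l) (hl2 : l ≤ σ)
    (Q : ℝ → Fin (n + 1) → ℝ) (hQ : ContDiff ℝ (⊤ : ℕ∞) Q)
    (hn0 : ∀ x : ℝ, Q x ⟨n - 1, by omega⟩ ≠ 0)
    (hn1 : ∀ x : ℝ, Q x ⟨n, by omega⟩ ≠ 0) (x : ℝ) :
    elExpr (lag n ((n : ℤ) - σ) 0) ⟨l - 1, by omega⟩ (fun y i => Q y i.castSucc) x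
      = elExpr (lag (n + 1) ((n : ℤ) + 1 - σ) 0) ⟨l - 1, by omega⟩ Q x := by
  have hd : ∀ y, deriv (fun y (i : Fin n) => Q y i.castSucc) y
      = fun i => deriv Q y i.castSucc := by
    intro y
    have hy : DifferentiableAt ℝ Q y := (hQ.differentiable (by simp)).differentiableAt
    have h1 := hasDerivAt_pi.1 hy.hasDerivAt
    exact (hasDerivAt_pi.2 fun i : Fin n => h1 i.castSucc).deriv
  have key : ∀ l' : Fin n, (l' : ℕ) < σ →
      elExpr (lag n ((n : ℤ) - σ) 0) l' (fun y i => Q y i.castSucc) x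
      = elExpr (lag (n + 1) (((n + 1 : ℕ) : ℤ) - σ) 0) l'.castSucc Q x := by
    intro l' hl'
    unfold elExpr
    simp only [hd]
    rw [pd_q_s7 n σ (by omega) l' hl', pd_q_s7 (n + 1) σ (by omega) l'.castSucc hl']
    simp only [pd_p_s7 n σ (by omega) l' hl', pd_p_s7 (n + 1) σ (by omega) l'.castSucc hl',
      stS_succ n σ (by omega), upd_castSucc]
  have := key ⟨l - 1, by omega⟩ (by simp only; omega)
  rw [this]
  push_cast
  rfl
end

section
/- For every σ ∈ {1,…,n−1}, every l ∈ {1,…,n−σ}, every smooth curve Q = (q_1,…,q_{n+1}) : ℝ → ℝ^{n+1} with q_{n+1} nowhere zero, and every x ∈ ℝ: E_{σ+l}(L^{n,n−σ,0})[(q_2,…,q_{n+1})](x) = E_{σ+l}(L^{n+1,n+1−σ,0})[Q](x); that is, the (σ+l)-th Euler–Lagrange expression of the n-variable geodesic density evaluated on the shifted curve (q_2,…,q_{n+1}) equals the (σ+l)-th Euler–Lagrange expression of the (n+1)-variable geodesic density on (q_1,…,q_{n+1}). -/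
open scoped BigOperators

open PowerSeries in
/-- coefficientwise derivative of a family of power series -/
def PSD (F : ℝ → PowerSeries ℝ) (F' : PowerSeries ℝ) (t : ℝ) : Prop :=
  ∀ k, HasDerivAt (fun s => PowerSeries.coeff k (F s)) (PowerSeries.coeff k F') t

theorem PSD.const (A : PowerSeries ℝ) (t : ℝ) : PSD (fun _ => A) 0 t := by
  intro k
  simpa using hasDerivAt_const t (PowerSeries.coeff k A)

theorem PSD.mul {F G : ℝ → PowerSeries ℝ} {F' G' : PowerSeries ℝ} {t : ℝ}
    (hF : PSD F F' t) (hG : PSD G G' t) :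
    PSD (fun s => F s * G s) (F' * G t + F t * G') t := by
  intro k
  simp only [PowerSeries.coeff_mul, map_add, ← Finset.sum_add_distrib]
  exact HasDerivAt.fun_sum fun p _ => (hF p.1).mul (hG p.2)

theorem PSD.inv {F : ℝ → PowerSeries ℝ} {F' : PowerSeries ℝ} {t : ℝ}
    (hF : PSD F F' t) (h0 : PowerSeries.constantCoeff (F t) ≠ 0) :
    PSD (fun s => (F s)⁻¹) (-(F' * (F t)⁻¹ ^ 2)) t := by
  have hc : HasDerivAt (fun s => PowerSeries.constantCoeff (F s))
      (PowerSeries.constantCoeff F') t := by simpa using hF 0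
  have hd : ∀ k, DifferentiableAt ℝ (fun s => PowerSeries.coeff k (F s)⁻¹) t := by
    intro k
    induction k using Nat.strong_induction_on with
    | _ k ih =>
      have hfe : (fun s => PowerSeries.coeff k (F s)⁻¹) = fun s => _ :=
        funext fun s => PowerSeries.coeff_inv k (F s)
      rw [hfe]
      split_ifs with hk
      · exact hc.differentiableAt.inv h0
      · refine DifferentiableAt.mul (hc.differentiableAt.inv h0).neg ?_
        refine DifferentiableAt.fun_sum fun p _ => ?_
        split_ifs with hp
        · exact (hF p.1).differentiableAt.mul (ih _ hp)
        · exact differentiableAt_const _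
  set D : PowerSeries ℝ :=
    PowerSeries.mk fun k => deriv (fun s => PowerSeries.coeff k (F s)⁻¹) t with hD
  have hDD : PSD (fun s => (F s)⁻¹) D t := by
    intro k
    simpa [hD] using (hd k).hasDerivAt
  have h1 := hDD.mul hF
  have hev : ∀ᶠ s in nhds t, PowerSeries.constantCoeff (F s) ≠ 0 :=
    hc.continuousAt.eventually_ne h0
  have h2 : D * F t + (F t)⁻¹ * F' = 0 := by
    ext k
    have h3 : HasDerivAt (fun s => PowerSeries.coeff k ((F s)⁻¹ * F s)) 0 t := by
      refine (hasDerivAt_const t (PowerSeries.coeff k (1 : PowerSeries ℝ))).congr_of_eventuallyEq ?_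
      filter_upwards [hev] with s hs
      rw [PowerSeries.inv_mul_cancel _ hs]
    simpa using (h1 k).unique h3
  have h4 : D = -(F' * (F t)⁻¹ ^ 2) := by
    have h5 := PowerSeries.mul_inv_cancel (F t) h0
    linear_combination (F t)⁻¹ * h2 - D * h5
  rw [← h4]
  exact hDD

/-- generating polynomial -/
noncomputable def PP (n : ℕ) (p : Fin n → ℝ) : PowerSeries ℝ :=
  ∑ i : Fin n, PowerSeries.C (p i) * PowerSeries.X ^ (n - 1 - (i : ℕ))

/-- generating polynomial with leading term -/
noncomputable def AA (n : ℕ) (q : Fin n → ℝ) : PowerSeries ℝ :=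
  PowerSeries.X ^ n + PP n q

theorem PP_update (n : ℕ) (p : Fin n → ℝ) (l : Fin n) (t : ℝ) :
    PP n (Function.update p l t) =
      PP n p + PowerSeries.C (t - p l) * PowerSeries.X ^ (n - 1 - (l : ℕ)) := by
  unfold PP
  rw [← Finset.add_sum_erase _ _ (Finset.mem_univ l),
    ← Finset.add_sum_erase _ (fun i => PowerSeries.C (p i) * _) (Finset.mem_univ l)]
  have : ∑ x ∈ Finset.univ.erase l, PowerSeries.C (Function.update p l t x) *
      (PowerSeries.X : PowerSeries ℝ) ^ (n - 1 - (x : ℕ)) =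
      ∑ x ∈ Finset.univ.erase l, PowerSeries.C (p x) * PowerSeries.X ^ (n - 1 - (x : ℕ)) := by
    refine Finset.sum_congr rfl fun x hx => ?_
    rw [Function.update_of_ne (Finset.ne_of_mem_erase hx)]
  rw [this]
  simp only [Function.update_self, map_sub]
  ring

theorem PP_succ (n : ℕ) (p : Fin (n + 1) → ℝ) :
    PP (n + 1) p = PowerSeries.C (p 0) * PowerSeries.X ^ n + PP n (fun i => p i.succ) := by
  unfold PP
  rw [Fin.sum_univ_succ]
  congr 1
  refine Finset.sum_congr rfl fun i _ => ?_
  congr 2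
  simp only [Fin.val_succ]
  omega

theorem coeff_PP (n : ℕ) (p : Fin n → ℝ) (t : ℕ) :
    PowerSeries.coeff t (PP n p) = if h : t < n then p ⟨n - 1 - t, by omega⟩ else 0 := by
  unfold PP
  rw [map_sum]
  simp only [PowerSeries.coeff_C_mul, PowerSeries.coeff_X_pow]
  split_ifs with h
  · rw [Finset.sum_eq_single ⟨n - 1 - t, by omega⟩]
    · rw [if_pos (by simp only; omega), mul_one]
    · intro b _ hb
      rw [if_neg, mul_zero]
      intro h'
      apply hb
      ext
      simp only
      omega
    · simp
  · refine Finset.sum_eq_zero fun i _ => ?_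
    rw [if_neg (by omega), mul_zero]

theorem coeff_AA (n : ℕ) (q : Fin n → ℝ) (t : ℕ) :
    PowerSeries.coeff t (AA n q) = qc n q ((n : ℤ) - t) := by
  unfold AA qc
  rw [map_add, coeff_PP, PowerSeries.coeff_X_pow]
  by_cases h1 : t = n
  · subst h1; simp
  · rw [if_neg h1, if_neg (by omega), zero_add]
    by_cases h2 : t < n
    · rw [dif_pos h2, dif_pos (by omega)]
      congr 2
      omega
    · rw [dif_neg h2, dif_neg (by omega)]

theorem constCoeff_AA (n : ℕ) (hn : 1 ≤ n) (q : Fin n → ℝ) :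
    PowerSeries.constantCoeff (AA n q) = q ⟨n - 1, by omega⟩ := by
  rw [← PowerSeries.coeff_zero_eq_constantCoeff_apply]
  unfold AA
  rw [map_add, coeff_PP, dif_pos (by omega), PowerSeries.coeff_X_pow, if_neg (by omega)]
  simp

theorem benenti_rec_neg (n : ℕ) (q : Fin n → ℝ) (s d : ℕ) (hn : 1 ≤ n) :
    benenti n ((n : ℤ) - d) (-((s + 1 : ℕ) : ℤ)) q =
      benenti n ((n : ℤ) - (d + 1 : ℕ)) (-(s : ℤ)) q
        - (qc n q ((n : ℤ) - (d + 1 : ℕ)) / qc n q n) * benenti n n (-(s : ℤ)) q := by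
  by_cases h : d < n
  · rw [benenti, if_neg (by omega), if_neg (by omega), if_neg (by omega)]
    have e1 : (n : ℤ) - d - 1 = (n : ℤ) - (d + 1 : ℕ) := by push_cast; ring
    have e2 : (-((s + 1 : ℕ) : ℤ)) + 1 = -(s : ℤ) := by push_cast; ring
    rw [e1, e2]
  · rw [benenti, if_pos (by omega), benenti, if_pos (by omega), qc, if_neg (by omega),
      dif_neg (by omega)]
    simp

theorem benenti_gen (n : ℕ) (hn : 1 ≤ n) (q : Fin n → ℝ) (hq : q ⟨n - 1, by omega⟩ ≠ 0)
    (j : ℕ) : ∀ s : ℕ,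
    PowerSeries.coeff j ((PowerSeries.mk fun d : ℕ => benenti n ((n : ℤ) - d) (-(s : ℤ)) q)
      * (AA n q)⁻¹) = benenti n n (-((s + j : ℕ) : ℤ)) q / q ⟨n - 1, by omega⟩ := by
  have hc := constCoeff_AA n hn q
  have hc0 : PowerSeries.constantCoeff (AA n q) ≠ 0 := by rw [hc]; exact hq
  induction j with
  | zero =>
    intro s
    simp [PowerSeries.constantCoeff_inv, hc, div_eq_mul_inv]
  | succ j ih =>
    intro s
    have hqn : qc n q n = q ⟨n - 1, by omega⟩ := by
      have := coeff_AA n q 0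
      rw [PowerSeries.coeff_zero_eq_constantCoeff_apply, hc] at this
      simpa using this.symm
    have key : (PowerSeries.mk fun d : ℕ => benenti n ((n : ℤ) - d) (-(s : ℤ)) q) =
        PowerSeries.C (benenti n n (-(s : ℤ)) q / q ⟨n - 1, by omega⟩) * AA n q +
        PowerSeries.X *
          (PowerSeries.mk fun d : ℕ => benenti n ((n : ℤ) - d) (-((s + 1 : ℕ) : ℤ)) q) := by
      ext d
      rw [map_add, PowerSeries.coeff_C_mul, PowerSeries.coeff_mk, coeff_AA]
      cases d with
      | zero =>
        simp only [Nat.cast_zero, sub_zero, PowerSeries.coeff_zero_X_mul, hqn]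
        field_simp
        simp
      | succ d =>
        rw [PowerSeries.coeff_succ_X_mul, PowerSeries.coeff_mk, benenti_rec_neg n q s d hn, hqn]
        ring
    rw [key, add_mul, mul_assoc, PowerSeries.mul_inv_cancel _ hc0, mul_one, mul_assoc, map_add,
      PowerSeries.coeff_succ_X_mul, ih (s + 1), PowerSeries.coeff_C, if_neg (by omega), zero_add]
    congr 3
    omega

theorem benenti_neg (n : ℕ) (hn : 1 ≤ n) (q : Fin n → ℝ) (hq : q ⟨n - 1, by omega⟩ ≠ 0)
    (s : ℕ) : benenti n 1 (-1 - (s : ℤ)) q = - PowerSeries.coeff s (AA n q)⁻¹ := by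
  have h := benenti_gen n hn q hq s 0
  have h1 : (PowerSeries.mk fun d : ℕ => benenti n ((n : ℤ) - d) (-((0 : ℕ) : ℤ)) q) = 1 := by
    ext d
    rw [PowerSeries.coeff_mk, PowerSeries.coeff_one, benenti]
    by_cases hd : d = 0
    · subst hd; simp; omega
    · rw [if_neg hd]
      split_ifs <;> first | rfl | omega
  rw [h1, one_mul] at h
  have hqn : qc n q n = q ⟨n - 1, by omega⟩ := by
    have := coeff_AA n q 0
    rw [PowerSeries.coeff_zero_eq_constantCoeff_apply, constCoeff_AA n hn] at this
    simpa using this.symm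
  rw [h, benenti, if_neg (by omega), if_neg (by omega), if_neg (by omega), hqn]
  have e : -1 - (s : ℤ) + 1 = -((0 + s : ℕ) : ℤ) := by push_cast; ring
  rw [e, benenti, if_pos (by omega)]
  simp [qc]
  ring

theorem benenti_zero (n : ℕ) (q : Fin n → ℝ) (k : ℕ) : ∀ r : ℤ, r + k < n →
    benenti n r k q = 0 := by
  induction k with
  | zero =>
    intro r h
    rw [benenti]
    split_ifs <;> first | rfl | omega
  | succ k ih =>
    intro r h
    rw [benenti]
    have e : ((k + 1 : ℕ) : ℤ) - 1 = k := by push_cast; ring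
    split_ifs
    · rfl
    · omega
    · omega
    · rw [e, ih _ (by push_cast at h; omega), ih _ (by push_cast at h; omega)]
      simp
    · omega

theorem benenti_congr (n : ℕ) (q q' : Fin n → ℝ) (w : ℤ)
    (hw : ∀ r : ℤ, r ≤ w → qc n q r = qc n q' r) (k : ℕ) : ∀ r : ℤ, r + k - n ≤ w →
    benenti n r k q = benenti n r k q' := by
  induction k with
  | zero =>
    intro r h
    rw [benenti.eq_1 n r _ q, benenti.eq_1 n r _ q']
    simp
  | succ k ih =>
    intro r h
    rw [benenti.eq_1 n r _ q, benenti.eq_1 n r _ q']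
    have e : ((k + 1 : ℕ) : ℤ) - 1 = k := by push_cast; ring
    push_cast at h
    split_ifs
    · rfl
    · rfl
    · rfl
    · rw [e, ih _ (by omega)]
      congr 1
      by_cases hk : 1 + (k : ℤ) < n
      · rw [benenti_zero n q k 1 hk, benenti_zero n q' k 1 hk]; simp
      · rw [ih 1 (by omega), hw r (by omega)]
    · omega

/-- nonnegative exponent part of the metric -/
noncomputable def Bp (n σ : ℕ) (i j : Fin n) (q : Fin n → ℝ) : ℝ :=
  if 0 ≤ (n : ℤ) + σ - i - j - 2 then benenti n 1 ((n : ℤ) + σ - i - j - 2) q else 0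

/-- nonnegative exponent part of the density -/
noncomputable def Lp (n σ : ℕ) (q p : Fin n → ℝ) : ℝ :=
  (1 / 2) * ∑ i : Fin n, ∑ j : Fin n, Bp n σ i j q * p i * p j

theorem lag_eq_s8 (n σ : ℕ) (hn : 2 ≤ n) (hσ : σ < n) (q p : Fin n → ℝ)
    (hq : q ⟨n - 1, by omega⟩ ≠ 0) :
    lag n ((n : ℤ) - σ) 0 q p =
      Lp n σ q p - (1 / 2) * PowerSeries.coeff (n - σ - 1) (PP n p * PP n p * (AA n q)⁻¹) := by
  have h0 : benenti n 1 0 q = 0 := by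
    have := benenti_zero n q 0 1 (by push_cast; omega)
    simpa using this
  unfold lag Lp
  rw [h0, sub_zero, ← mul_sub]
  congr 1
  have e : PP n p * PP n p * (AA n q)⁻¹ = ∑ i : Fin n, ∑ j : Fin n,
      PowerSeries.C (p i * p j) *
        (PowerSeries.X ^ ((n - 1 - (i : ℕ)) + (n - 1 - (j : ℕ))) * (AA n q)⁻¹) := by
    conv_lhs => unfold PP
    rw [Finset.sum_mul_sum, Finset.sum_mul]
    refine Finset.sum_congr rfl fun i _ => ?_
    rw [Finset.sum_mul]
    refine Finset.sum_congr rfl fun j _ => ?_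
    rw [map_mul, pow_add]
    ring
  rw [e, map_sum, ← Finset.sum_sub_distrib]
  refine Finset.sum_congr rfl fun i _ => ?_
  rw [map_sum, ← Finset.sum_sub_distrib]
  refine Finset.sum_congr rfl fun j _ => ?_
  rw [PowerSeries.coeff_C_mul, PowerSeries.coeff_X_pow_mul']
  have e1 : 2 * (n : ℤ) - ((n : ℤ) - σ) - ((i : ℕ) + 1) - ((j : ℕ) + 1)
      = (n : ℤ) + σ - i - j - 2 := by ring
  rw [e1]
  unfold Bp
  have hi := i.2
  have hj := j.2
  by_cases h : 0 ≤ (n : ℤ) + σ - i - j - 2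
  · rw [if_pos h, if_neg (by omega)]; ring
  · rw [if_neg h, if_pos (by omega)]
    have e2 : (n : ℤ) + σ - i - j - 2 =
        -1 - ((n - σ - 1 - (n - 1 - (i : ℕ) + (n - 1 - (j : ℕ))) : ℕ) : ℤ) := by omega
    rw [e2, benenti_neg n (by omega) q hq]
    ring

theorem Lp_update_q (n σ : ℕ) (q p : Fin n → ℝ) (l : Fin n) (hl : σ ≤ l) (t : ℝ) :
    Lp n σ (Function.update q l t) p = Lp n σ q p := by
  unfold Lp
  congr 1
  refine Finset.sum_congr rfl fun i _ => Finset.sum_congr rfl fun j _ => ?_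
  congr 2
  unfold Bp
  split_ifs with h
  · obtain ⟨k, hk⟩ := Int.eq_ofNat_of_zero_le h
    rw [hk]
    refine benenti_congr n _ _ σ ?_ k 1 (by omega)
    intro r hr
    unfold qc
    split_ifs with h1 h2
    · rfl
    · rw [Function.update_of_ne]
      intro h3
      rw [← h3] at hl
      simp only at hl
      omega
    · rfl
  · rfl

theorem Bp_zero (n σ : ℕ) (q : Fin n → ℝ) (i j : Fin n) (h : σ ≤ (i : ℕ) + j) :
    Bp n σ i j q = 0 := by
  unfold Bp
  split_ifs with h0
  · obtain ⟨k, hk⟩ := Int.eq_ofNat_of_zero_le h0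
    rw [hk]
    exact benenti_zero n q k 1 (by omega)
  · rfl

theorem Lp_update_p (n σ : ℕ) (q p : Fin n → ℝ) (l : Fin n) (hl : σ ≤ l) (t : ℝ) :
    Lp n σ q (Function.update p l t) = Lp n σ q p := by
  unfold Lp
  congr 1
  refine Finset.sum_congr rfl fun i _ => Finset.sum_congr rfl fun j _ => ?_
  by_cases h : σ ≤ (i : ℕ) + j
  · rw [Bp_zero n σ q i j h]; simp
  · rw [Function.update_of_ne, Function.update_of_ne]
    · rintro rfl; omega
    · rintro rfl; omega

theorem PSD_line (A : PowerSeries ℝ) (d : ℕ) (t : ℝ) :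
    PSD (fun s => A + PowerSeries.C (s - t) * PowerSeries.X ^ d) (PowerSeries.X ^ d) t := by
  intro k
  simp only [map_add, PowerSeries.coeff_C_mul]
  have := ((((hasDerivAt_id t).sub_const t).mul_const
    (PowerSeries.coeff k (PowerSeries.X ^ d : PowerSeries ℝ)))).const_add (PowerSeries.coeff k A)
  simpa using this

theorem coeff_shift (n σ l : ℕ) (hσ : σ ≤ l) (hl : l < n) (F : PowerSeries ℝ) :
    PowerSeries.coeff (n - σ - 1) (PowerSeries.X ^ (n - 1 - l) * F) =
      PowerSeries.coeff (l - σ) F := by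
  rw [PowerSeries.coeff_X_pow_mul', if_pos (by omega)]
  congr 2
  omega

theorem pd_q_s8 (n σ : ℕ) (hn : 2 ≤ n) (q p : Fin n → ℝ) (l : Fin n) (hl : σ ≤ l)
    (hq : q ⟨n - 1, by omega⟩ ≠ 0) :
    pd (fun vq => lag n ((n : ℤ) - σ) 0 vq p) l q =
      (1 / 2) * PowerSeries.coeff (l - σ) (PP n p * PP n p * (AA n q)⁻¹ ^ 2) := by
  have hl2 := l.2
  unfold pd
  have hA : ∀ s, AA n (Function.update q l s) =
      AA n q + PowerSeries.C (s - q l) * PowerSeries.X ^ (n - 1 - (l : ℕ)) := by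
    intro s
    unfold AA
    rw [PP_update, add_assoc]
  have hc : PowerSeries.constantCoeff (AA n q) ≠ 0 := by
    rw [constCoeff_AA n (by omega)]; exact hq
  have h1 := (PSD.const (PP n p * PP n p) (q l)).mul
    ((PSD_line (AA n q) (n - 1 - (l : ℕ)) (q l)).inv (by simpa using hc))
  have h2 := ((h1 (n - σ - 1)).const_mul (1 / 2)).const_sub (Lp n σ q p)
  have hev : ∀ᶠ s in nhds (q l), Function.update q l s ⟨n - 1, by omega⟩ ≠ 0 := by
    have hcont : ContinuousAt (fun s => Function.update q l s ⟨n - 1, by omega⟩) (q l) := by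
      have : Continuous (fun s => Function.update q l s) := by fun_prop
      exact ((continuous_apply _).comp this).continuousAt
    apply hcont.eventually_ne
    simpa using hq
  refine Eq.trans (HasDerivAt.deriv (h2.congr_of_eventuallyEq ?_)) ?_
  · filter_upwards [hev] with s hs
    rw [lag_eq_s8 n σ hn (by omega) _ _ hs, Lp_update_q n σ q p l hl, hA]
  · rw [← coeff_shift n σ l hl hl2]
    simp only [sub_self, map_zero, zero_mul, add_zero, zero_add]
    rw [← mul_neg, ← map_neg]
    congr 2
    ring

theorem pd_p_s8 (n σ : ℕ) (hn : 2 ≤ n) (q p : Fin n → ℝ) (l : Fin n) (hl : σ ≤ l)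
    (hq : q ⟨n - 1, by omega⟩ ≠ 0) :
    pd (fun vp => lag n ((n : ℤ) - σ) 0 q vp) l p =
      - PowerSeries.coeff (l - σ) (PP n p * (AA n q)⁻¹) := by
  have hl2 := l.2
  unfold pd
  have h0 := PSD_line (PP n p) (n - 1 - (l : ℕ)) (p l)
  have h1 := (h0.mul h0).mul (PSD.const (AA n q)⁻¹ (p l))
  have h2 := ((h1 (n - σ - 1)).const_mul (1 / 2)).const_sub (Lp n σ q p)
  refine Eq.trans (HasDerivAt.deriv (h2.congr_of_eventuallyEq ?_)) ?_
  · filter_upwards with s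
    rw [lag_eq_s8 n σ hn (by omega) _ _ hq, Lp_update_p n σ q p l hl, PP_update]
  · rw [← coeff_shift n σ l hl hl2]
    simp only [sub_self, map_zero, zero_mul, add_zero, mul_zero]
    have e : (PowerSeries.X ^ (n - 1 - (l : ℕ)) * PP n p + PP n p * PowerSeries.X ^ (n - 1 - (l : ℕ)))
        * (AA n q)⁻¹ = PowerSeries.C 2 * (PowerSeries.X ^ (n - 1 - (l : ℕ)) * (PP n p * (AA n q)⁻¹)) := by
      have : (PowerSeries.C (2 : ℝ)) = 2 := map_ofNat _ 2
      rw [this]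
      ring
    rw [e, PowerSeries.coeff_C_mul]
    ring

theorem inv_congr {A B I : PowerSeries ℝ} (hA : PowerSeries.constantCoeff A ≠ 0)
    (hB : PowerSeries.constantCoeff B ≠ 0) (h : I ∣ A - B) : I ∣ A⁻¹ - B⁻¹ := by
  have h1 := PowerSeries.mul_inv_cancel A hA
  have h2 := PowerSeries.mul_inv_cancel B hB
  have : A⁻¹ - B⁻¹ = (A - B) * (-(A⁻¹ * B⁻¹)) := by
    linear_combination B⁻¹ * h1 - A⁻¹ * h2
  rw [this]
  exact h.mul_right _

theorem mul_congr' {A B C D I : PowerSeries ℝ} (h : I ∣ A - B) (h' : I ∣ C - D) :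
    I ∣ A * C - B * D := by
  have : A * C - B * D = (A - B) * C + B * (C - D) := by ring
  rw [this]
  exact dvd_add (h.mul_right _) (h'.mul_left _)

theorem coeff_congr {A B : PowerSeries ℝ} {n k : ℕ} (h : PowerSeries.X ^ n ∣ A - B)
    (hk : k < n) : PowerSeries.coeff k A = PowerSeries.coeff k B := by
  have := (PowerSeries.X_pow_dvd_iff.1 h) k hk
  rwa [map_sub, sub_eq_zero] at this

theorem PP_congr (n : ℕ) (p : Fin (n + 1) → ℝ) :
    PowerSeries.X ^ n ∣ PP n (fun i => p i.succ) - PP (n + 1) p := by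
  rw [PP_succ]
  exact ⟨-PowerSeries.C (p 0), by ring⟩

theorem AA_congr (n : ℕ) (p : Fin (n + 1) → ℝ) :
    PowerSeries.X ^ n ∣ AA n (fun i => p i.succ) - AA (n + 1) p := by
  unfold AA
  rw [PP_succ]
  exact ⟨1 - PowerSeries.X - PowerSeries.C (p 0), by ring⟩

/-- for every `σ ∈ {1,…,n−1}`, `l ∈ {1,…,n−σ}`, every smooth curve
`Q = (q₁,…,q_{n+1})` with `q_{n+1}` nowhere zero, and every `x`: the `(σ+l)`-th
Euler–Lagrange expression of the `n`-variable geodesic density on the shifted curve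
`(q₂,…,q_{n+1})` equals the `(σ+l)`-th Euler–Lagrange expression of the
`(n+1)`-variable geodesic density on `Q`. -/
theorem el_geodesic_shifted_stabilization
    (n : ℕ) (hn : 1 ≤ n) (σ : ℕ) (hσ1 : 1 ≤ σ) (hσ2 : σ ≤ n - 1)
    (l : ℕ) (hl1 : 1 ≤ l) (hl2 : l ≤ n - σ)
    (Q : ℝ → Fin (n + 1) → ℝ) (hQ : ContDiff ℝ (⊤ : ℕ∞) Q)
    (hn1 : ∀ x : ℝ, Q x ⟨n, by omega⟩ ≠ 0) (x : ℝ) :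
    elExpr (lag n ((n : ℤ) - σ) 0) ⟨σ + l - 1, by omega⟩ (fun y i => Q y i.succ) x
      = elExpr (lag (n + 1) ((n : ℤ) + 1 - σ) 0) ⟨σ + l - 1, by omega⟩ Q x := by
  have hn2 : 2 ≤ n := by omega
  have hd : ∀ y, deriv (fun y (i : Fin n) => Q y i.succ) y = fun i => deriv Q y i.succ := by
    intro y
    have hQd : DifferentiableAt ℝ Q y := (hQ.differentiable (by simp)) y
    have hQi : ∀ i, DifferentiableAt ℝ (fun y => Q y i) y := differentiableAt_pi.1 hQd
    rw [deriv_pi fun i => hQi _, deriv_pi hQi]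
  have hq1 : ∀ y, (fun i : Fin n => Q y i.succ) ⟨n - 1, by omega⟩ ≠ 0 := by
    intro y
    have := hn1 y
    convert this using 2
    ext
    simp only [Fin.val_succ]
    omega
  have hq2 : ∀ y, Q y ⟨n + 1 - 1, by omega⟩ ≠ 0 := fun y => hn1 y
  have hinv : ∀ y, PowerSeries.X ^ n ∣ (AA n (fun i => Q y i.succ))⁻¹ - (AA (n + 1) (Q y))⁻¹ := by
    intro y
    apply inv_congr _ _ (AA_congr n (Q y))
    · rw [constCoeff_AA n hn]; exact hq1 y
    · rw [constCoeff_AA (n + 1) (by omega)]; exact hq2 y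
  have ec : (n : ℤ) + 1 - σ = ((n + 1 : ℕ) : ℤ) - σ := by push_cast; ring
  unfold elExpr
  rw [ec]
  congr 1
  · rw [hd, pd_q_s8 n σ hn2 _ _ _ (by simp only; omega) (hq1 x),
      pd_q_s8 (n + 1) σ (by omega) _ _ _ (by simp only; omega) (hq2 x)]
    congr 1
    refine coeff_congr (n := n) ?_ (by simp only; omega)
    rw [pow_two, pow_two]
    exact mul_congr' (mul_congr' (PP_congr n _) (PP_congr n _)) (mul_congr' (hinv x) (hinv x))
  · congr 1
    funext y
    rw [hd, pd_p_s8 n σ hn2 _ _ _ (by simp only; omega) (hq1 y),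
      pd_p_s8 (n + 1) σ (by omega) _ _ _ (by simp only; omega) (hq2 y)]
    congr 1
    refine coeff_congr (n := n) ?_ (by simp only; omega)
    exact mul_congr' (PP_congr n _) (hinv y)
end

section
/- For every i ∈ {1,…,n} and every point (q_1,…,q_{n+1}) ∈ ℝ^{n+1} with q_{n+1} ≠ 0, the following three quantities are equal: (∂V_1^{n,(−n)}/∂q_i) evaluated at the shifted point (q_2,…,q_{n+1}); (∂V_1^{n+1,(−n)}/∂q_{i+1}) evaluated at (q_1,…,q_{n+1}); and (∂V_1^{n+1,(−n−1)}/∂q_i) evaluated at (q_1,…,q_{n+1}). -/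
open scoped BigOperators

noncomputable def bP (n : ℕ) (q : Fin n → ℝ) : PowerSeries ℝ :=
  PowerSeries.mk fun j => qc n q ((n : ℤ) - j)

theorem bP_cc (n : ℕ) (q : Fin n → ℝ) : PowerSeries.constantCoeff (bP n q) = qc n q n := by
  rw [← PowerSeries.coeff_zero_eq_constantCoeff_apply]
  simp [bP]

theorem qc_neg (n : ℕ) (q : Fin n → ℝ) (r : ℤ) (h : r < 0) : qc n q r = 0 := by
  unfold qc
  rw [if_neg (by omega), dif_neg (by omega)]

theorem qc_val (n : ℕ) (q : Fin n → ℝ) (j : Fin n) (r : ℤ) (h : r = (j : ℕ) + 1) :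
    qc n q r = q j := by
  subst h
  unfold qc
  rw [if_neg (by omega), dif_pos (by omega)]
  congr 1
  ext
  simp

theorem bP_sum (n : ℕ) (q : Fin n → ℝ) (h : qc n q n ≠ 0) (k : ℕ) :
    ∑ j ∈ Finset.range (k + 1),
      qc n q ((n : ℤ) - j) * PowerSeries.coeff (k - j) (bP n q)⁻¹ = if k = 0 then 1 else 0 := by
  have h1 : bP n q * (bP n q)⁻¹ = 1 := PowerSeries.mul_inv_cancel _ (by rwa [bP_cc])
  have h2 := congrArg (PowerSeries.coeff k) h1
  rw [PowerSeries.coeff_mul, Finset.Nat.sum_antidiagonal_eq_sum_range_succ_mk,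
    PowerSeries.coeff_one] at h2
  rw [← h2]
  simp [bP]

theorem benenti_closed (n : ℕ) (hn : 1 ≤ n) (q : Fin n → ℝ) (h : qc n q n ≠ 0) (k : ℕ) :
    ∀ r : ℤ, 0 ≤ r → r ≤ n → benenti n r (-(k : ℤ)) q =
      (if k = 0 ∧ r = n then 1 else 0) - ∑ j ∈ Finset.range k,
        qc n q (r - 1 - j) * PowerSeries.coeff (k - 1 - j) (bP n q)⁻¹ := by
  induction k with
  | zero =>
    intro r h0 h1
    rw [benenti]
    by_cases hr : r = n
    · rw [if_neg (by omega)]; simp [hr]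
    · simp [hr]
  | succ k ih =>
    intro r h0 h1
    rcases h0.eq_or_lt with h0 | h0
    · subst h0
      rw [benenti, if_pos (by omega), if_neg (by omega), Finset.sum_eq_zero, sub_zero]
      intro j _
      rw [qc_neg n q (0 - 1 - j) (by omega), zero_mul]
    · rw [benenti, if_neg (by omega), if_neg (by omega), if_neg (by omega), if_neg (by omega)]
      have e : (-((k + 1 : ℕ) : ℤ) + 1) = -(k : ℤ) := by push_cast; ring
      rw [e, ih (r - 1) (by omega) (by omega), ih n (by omega) le_rfl]
      have hs := bP_sum n q h k
      rw [Finset.sum_range_succ'] at hs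
      rw [if_neg (by omega), Finset.sum_range_succ']
      have e1 : ∀ s : ℤ, ∑ j ∈ Finset.range k,
          qc n q (s - ((j + 1 : ℕ) : ℤ)) * PowerSeries.coeff (k - (j + 1)) (bP n q)⁻¹ =
          ∑ j ∈ Finset.range k,
          qc n q (s - 1 - j) * PowerSeries.coeff (k - 1 - j) (bP n q)⁻¹ := by
        intro s
        refine Finset.sum_congr rfl fun j _ => ?_
        congr 2
        · push_cast; ring
        · congr 1; omega
      have e2 := e1 (r - 1)
      rw [e1] at hs
      simp only [Nat.add_sub_cancel, Nat.cast_zero, sub_zero, Nat.sub_zero, and_true] at hs e2 ⊢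
      rw [e2, ← hs]
      field_simp
      ring

theorem benenti_one_s9 (n : ℕ) (hn : 1 ≤ n) (q : Fin n → ℝ) (h : qc n q n ≠ 0) (k : ℕ) :
    benenti n 1 (-(k : ℤ) - 1) q = - PowerSeries.coeff k (bP n q)⁻¹ := by
  have := benenti_closed n hn q h (k + 1) 1 (by omega) (by omega)
  rw [show (-(k : ℤ) - 1) = -((k + 1 : ℕ) : ℤ) by push_cast; ring, this, if_neg (by omega),
    Finset.sum_range_succ', Finset.sum_eq_zero]
  · simp [qc]
  · intro j _
    rw [qc_neg n q (1 - 1 - ((j + 1 : ℕ) : ℤ)) (by omega), zero_mul]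

theorem cont_inv (c : ℝ → PowerSeries ℝ) (a : ℝ)
    (hc : ∀ k, ContinuousAt (fun t => PowerSeries.coeff k (c t)) a)
    (h0 : PowerSeries.constantCoeff (c a) ≠ 0) (k : ℕ) :
    ContinuousAt (fun t => PowerSeries.coeff k (c t)⁻¹) a := by
  have hi : ContinuousAt (fun t => (PowerSeries.constantCoeff (c t))⁻¹) a := by
    refine ContinuousAt.inv₀ ?_ h0
    simpa using hc 0
  induction k using Nat.strong_induction_on with
  | _ k ih =>
    have hfe := funext fun t => PowerSeries.coeff_inv k (c t)
    rw [hfe]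
    split_ifs with hk
    · exact hi
    · refine hi.neg.mul ?_
      refine tendsto_finsetSum _ fun x _ => ?_
      split_ifs with hx
      · exact (hc _).mul (ih _ hx)
      · exact tendsto_const_nhds

theorem bP_update (n : ℕ) (q : Fin n → ℝ) (i : Fin n) (t : ℝ) :
    bP n (Function.update q i t) =
      bP n q + PowerSeries.C (t - q i) * PowerSeries.X ^ (n - 1 - (i : ℕ)) := by
  ext j
  rw [map_add, PowerSeries.coeff_C_mul, PowerSeries.coeff_X_pow]
  simp only [bP, PowerSeries.coeff_mk]
  by_cases hj : j = n - 1 - i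
  · rw [qc_val n (Function.update q i t) i ((n : ℤ) - j) (by omega), qc_val n q i ((n : ℤ) - j) (by omega)]
    simp [hj]
  · rw [if_neg hj, mul_zero, add_zero]
    unfold qc
    split_ifs with h1 h2
    · rfl
    · rw [Function.update_of_ne]
      intro h
      have := congrArg Fin.val h
      simp at this
      omega
    · rfl

theorem pd_benenti (n : ℕ) (hn : 1 ≤ n) (q : Fin n → ℝ) (h : qc n q n ≠ 0) (k : ℕ) (i : Fin n) :
    pd (benenti n 1 (-(k : ℤ) - 1)) i q =
      PowerSeries.coeff k (((bP n q)⁻¹) ^ 2 * PowerSeries.X ^ (n - 1 - (i : ℕ))) := by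
  set m := n - 1 - (i : ℕ) with hm
  have hc : ∀ k, ContinuousAt (fun t => PowerSeries.coeff k (bP n (Function.update q i t))) (q i) := by
    intro k
    simp only [bP_update, map_add, PowerSeries.coeff_C_mul]
    fun_prop
  have hcc : ContinuousAt (fun t => qc n (Function.update q i t) n) (q i) := by
    have := hc 0
    simpa [bP_cc] using this
  have hne : ∀ᶠ t in nhds (q i), qc n (Function.update q i t) n ≠ 0 := by
    refine hcc.eventually_ne ?_
    simpa using h
  have hw := cont_inv (fun t => bP n (Function.update q i t)) (q i) hc (by simpa [bP_cc] using h)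
  unfold pd
  refine HasDerivAt.deriv ?_
  rw [hasDerivAt_iff_tendsto_slope]
  have hg : Filter.Tendsto (fun t => PowerSeries.coeff k
      ((bP n (Function.update q i t))⁻¹ * ((bP n q)⁻¹ * PowerSeries.X ^ m)))
      (nhdsWithin (q i) {q i}ᶜ) (nhds (PowerSeries.coeff k
        (((bP n q)⁻¹) ^ 2 * PowerSeries.X ^ m))) := by
    refine Filter.Tendsto.mono_left ?_ nhdsWithin_le_nhds
    have : ContinuousAt (fun t => PowerSeries.coeff k
      ((bP n (Function.update q i t))⁻¹ * ((bP n q)⁻¹ * PowerSeries.X ^ m))) (q i) := by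
      simp only [PowerSeries.coeff_mul k (_)⁻¹]
      exact tendsto_finsetSum _ fun x _ => (hw _).mul tendsto_const_nhds
    have h2 := this.tendsto
    simp only [Function.update_eq_self] at h2
    rwa [← mul_assoc, ← pow_two] at h2
  refine hg.congr' ?_
  filter_upwards [nhdsWithin_le_nhds hne, self_mem_nhdsWithin] with t ht hta
  have hta' : t - q i ≠ 0 := sub_ne_zero.2 hta
  rw [slope_def_field, Function.update_eq_self, benenti_one_s9 n hn _ ht, benenti_one_s9 n hn _ h,
    eq_div_iff hta', mul_comm, ← PowerSeries.coeff_C_mul, neg_sub_neg, ← map_sub]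
  congr 1
  have a1 := PowerSeries.mul_inv_cancel (bP n q) (by rwa [bP_cc])
  have a2 := PowerSeries.mul_inv_cancel (bP n (Function.update q i t)) (by rwa [bP_cc])
  have a3 := bP_update n q i t
  rw [← hm] at a3
  have a4 : PowerSeries.C (t - q i) * PowerSeries.X ^ m =
    bP n (Function.update q i t) - bP n q := by rw [a3]; ring
  calc _ = (PowerSeries.C (t - q i) * PowerSeries.X ^ m) * ((bP n (Function.update q i t))⁻¹ * (bP n q)⁻¹) := by ring
    _ = _ := by
      rw [a4]
      linear_combination (bP n q)⁻¹ * a2 - (bP n (Function.update q i t))⁻¹ * a1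

theorem bP_shift (n : ℕ) (hn : 1 ≤ n) (Q : Fin (n + 1) → ℝ)
    (h1 : qc n (fun j => Q j.succ) n ≠ 0) (h2 : qc (n + 1) Q ((n + 1 : ℕ) : ℤ) ≠ 0) (k : ℕ)
    (hk : k < n) :
    PowerSeries.coeff k ((bP n (fun j => Q j.succ))⁻¹ ^ 2) =
      PowerSeries.coeff k ((bP (n + 1) Q)⁻¹ ^ 2) := by
  set A := bP n (fun j => Q j.succ) with hA
  set B := bP (n + 1) Q with hB
  have hd : PowerSeries.X ^ n ∣ B - A := by
    rw [PowerSeries.X_pow_dvd_iff]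
    intro j hj
    simp only [hA, hB, bP, map_sub, PowerSeries.coeff_mk]
    rw [qc_val (n + 1) Q ⟨n - j, by omega⟩ (((n + 1 : ℕ) : ℤ) - j) (by push_cast [Nat.cast_sub hj.le]; ring),
      qc_val n _ ⟨n - 1 - j, by omega⟩ ((n : ℤ) - j) (by grind), sub_eq_zero]
    congr 1
    ext
    simp only [Fin.val_succ]
    omega
  have a1 := PowerSeries.mul_inv_cancel A (by rwa [hA, bP_cc])
  have a2 := PowerSeries.mul_inv_cancel B (by rwa [hB, bP_cc])
  have hd2 : PowerSeries.X ^ n ∣ A⁻¹ ^ 2 - B⁻¹ ^ 2 := by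
    have : A⁻¹ ^ 2 - B⁻¹ ^ 2 = (B - A) * (A⁻¹ * B⁻¹ * (A⁻¹ + B⁻¹)) := by
      linear_combination (-A⁻¹ * (A⁻¹ + B⁻¹)) * a2 + B⁻¹ * (A⁻¹ + B⁻¹) * a1
    rw [this]
    exact Dvd.dvd.mul_right hd _
  have := PowerSeries.X_pow_dvd_iff.1 hd2 k hk
  rwa [map_sub, sub_eq_zero] at this

/-- for every `i ∈ {1,…,n}` and every `(q₁,…,q_{n+1})` with `q_{n+1} ≠ 0`:
`(∂V₁^{n,(−n)}/∂q_i)` at the shifted point `(q₂,…,q_{n+1})`,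
`(∂V₁^{n+1,(−n)}/∂q_{i+1})` at `(q₁,…,q_{n+1})`, and
`(∂V₁^{n+1,(−n−1)}/∂q_i)` at `(q₁,…,q_{n+1})` are all equal. -/
theorem benenti_negative_derivative_shift
    (n : ℕ) (hn : 1 ≤ n) (i : ℕ) (hi1 : 1 ≤ i) (hi2 : i ≤ n)
    (Q : Fin (n + 1) → ℝ) (hQ : Q ⟨n, by omega⟩ ≠ 0) :
    pd (benenti n 1 (-(n : ℤ))) ⟨i - 1, by omega⟩ (fun j => Q j.succ)
        = pd (benenti (n + 1) 1 (-(n : ℤ))) ⟨i, by omega⟩ Q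
      ∧ pd (benenti (n + 1) 1 (-(n : ℤ))) ⟨i, by omega⟩ Q
        = pd (benenti (n + 1) 1 (-(n : ℤ) - 1)) ⟨i - 1, by omega⟩ Q := by
  have hq2 : qc (n + 1) Q ((n + 1 : ℕ) : ℤ) ≠ 0 := by
    rwa [qc_val (n + 1) Q ⟨n, by omega⟩ ((n + 1 : ℕ) : ℤ) (by push_cast; ring)]
  have hq1 : qc n (fun j => Q j.succ) n ≠ 0 := by
    rw [qc_val n _ ⟨n - 1, by omega⟩ (n : ℤ) (by grind)]
    convert hQ using 2
    ext
    simp only [Fin.val_succ]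
    omega
  have e : -(n : ℤ) = -((n - 1 : ℕ) : ℤ) - 1 := by omega
  have h3 := pd_benenti (n + 1) (by omega) Q hq2 n ⟨i - 1, by omega⟩
  have h2 := pd_benenti (n + 1) (by omega) Q hq2 (n - 1) ⟨i, by omega⟩
  have h1 := pd_benenti n hn (fun j => Q j.succ) hq1 (n - 1) ⟨i - 1, by omega⟩
  rw [← e] at h1 h2
  rw [h1, h2, h3]
  simp only [PowerSeries.coeff_mul_X_pow']
  rw [if_pos (by omega), if_pos (by omega), if_pos (by omega),
    show n - 1 - (n - 1 - (i - 1)) = i - 1 by omega, show n - 1 - (n + 1 - 1 - i) = i - 1 by omega,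
    show n - (n + 1 - 1 - (i - 1)) = i - 1 by omega]
  exact ⟨bP_shift n hn Q hq1 hq2 (i - 1) (by omega), rfl⟩
end
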